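/- arXiv:2403.20094 — 8 statements merged into one kernel-verified Lean document; each statement's English description precedes it below -/
import Mathlib

section
/- Assume the non-resonant condition holds (β ∈ ℝ arbitrary). Then the birth–death kernel p is irreducible: for all k, ℓ ∈ ℕ there exists t ∈ ℕ with p^t(k,ℓ) > 0. (Part of Proposition 3.1.) -/
open MeasureTheory Filter Real
open scoped ENNReal

noncomputable def pMinus (β ε : ℝ) : ℝ := 1 / (1 + Real.exp (-(β * ε)))

noncomputable def pPlus (β ε : ℝ) : ℝ := Real.exp (-(β * ε)) / (1 + Real.exp (-(β * ε)))

noncomputable def rabiAlpha (ξ η : ℝ) (k : ℕ) : ℝ :=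
  if k = 0 then 0
  else Real.sin (Real.pi * Real.sqrt (ξ * k + η)) ^ 2 * (ξ * k) / (ξ * k + η)

def IsRabiResonance (ξ η : ℝ) (n : ℕ) : Prop :=
  1 ≤ n ∧ ∃ j : ℕ, ξ * n + η = (j : ℝ) ^ 2

def NonResonant (ξ η : ℝ) : Prop := ∀ n : ℕ, ¬ IsRabiResonance ξ η n

noncomputable def bdKernel (β ε ξ η : ℝ) (k l : ℕ) : ℝ :=
  if l = k + 1 then pPlus β ε * rabiAlpha ξ η (k + 1)
  else if l + 1 = k then pMinus β ε * rabiAlpha ξ η k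
  else if l = k then 1 - pMinus β ε * rabiAlpha ξ η k - pPlus β ε * rabiAlpha ξ η (k + 1)
  else 0

noncomputable def muGibbs (β ε : ℝ) (k : ℕ) : ℝ :=
  (1 - Real.exp (-(β * ε))) * Real.exp (-(k : ℝ) * (β * ε))

noncomputable def bdKernelPow (β ε ξ η : ℝ) : ℕ → ℕ → ℕ → ℝ
  | 0, k, l => if k = l then 1 else 0
  | t + 1, k, l => ∑' j : ℕ, bdKernelPow β ε ξ η t k j * bdKernel β ε ξ η j l

inductive Outcome : Type
  | mm | mp | pm | pp
  deriving DecidableEq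

instance : MeasurableSpace Outcome := ⊤

noncomputable def stepWeight (β ε ξ η : ℝ) (k : ℕ) : Outcome → ℝ
  | .mm => pMinus β ε * (1 - rabiAlpha ξ η k)
  | .mp => pMinus β ε * rabiAlpha ξ η k
  | .pm => pPlus β ε * rabiAlpha ξ η (k + 1)
  | .pp => pPlus β ε * (1 - rabiAlpha ξ η (k + 1))

def stepSucc (k : ℕ) : Outcome → ℕ
  | .mm => k
  | .mp => k - 1
  | .pm => k + 1
  | .pp => k

noncomputable def wordWeight (β ε ξ η : ℝ) : ℕ → List Outcome → ℝ
  | _, [] => 1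
  | k, a :: w => stepWeight β ε ξ η k a * wordWeight β ε ξ η (stepSucc k a) w

def cylinder (w : List Outcome) : Set (ℕ → Outcome) :=
  {ω | ∀ i : Fin w.length, ω i = w.get i}

def outDelta : Outcome → ℤ
  | .mp => -1
  | .pm => 1
  | _ => 0

def sShift (ω : ℕ → Outcome) (t : ℕ) : ℤ := ∑ u ∈ Finset.range t, outDelta (ω u)

noncomputable def tauExt (k : ℕ) (ω : ℕ → Outcome) : ℕ∞ :=
  sInf ((fun t : ℕ => (t : ℕ∞)) '' {t : ℕ | 1 ≤ t ∧ (k : ℤ) + sShift ω t < 0})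

noncomputable def NFock (k : ℕ) (ω : ℕ → Outcome) (t : ℕ) : ℤ :=
  if (t : ℕ∞) < tauExt k ω then (k : ℤ) + sShift ω t else -1

noncomputable def firstReturn (k : ℕ) (ω : ℕ → Outcome) : ℕ∞ :=
  sInf ((fun t : ℕ => (t : ℕ∞)) '' {t : ℕ | 1 ≤ t ∧ NFock k ω t = (k : ℤ)})

theorem aux_alpha_pos (ξ η : ℝ) (hξ : 0 < ξ) (hη : 0 ≤ η)
    (hnr : NonResonant ξ η) (k : ℕ) : 0 < rabiAlpha ξ η (k + 1) := by
  unfold rabiAlpha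
  rw [if_neg (Nat.succ_ne_zero k)]
  have hk : (0 : ℝ) < ((k + 1 : ℕ) : ℝ) := by positivity
  have h1 : 0 < ξ * ((k + 1 : ℕ) : ℝ) := mul_pos hξ hk
  have h2 : 0 < ξ * ((k + 1 : ℕ) : ℝ) + η := by linarith
  have hs : Real.sin (Real.pi * Real.sqrt (ξ * ((k + 1 : ℕ) : ℝ) + η)) ≠ 0 := by
    intro h
    obtain ⟨n, hn⟩ := Real.sin_eq_zero_iff.1 h
    have hq : (n : ℝ) = Real.sqrt (ξ * ((k + 1 : ℕ) : ℝ) + η) := by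
      have := Real.pi_ne_zero
      apply mul_left_cancel₀ this
      linarith
    refine hnr (k + 1) ⟨by omega, n.natAbs, ?_⟩
    have h3 : ((n.natAbs : ℕ) : ℝ) ^ 2 = (n : ℝ) ^ 2 := by
      rw [Nat.cast_natAbs, Int.cast_abs, sq_abs]
    rw [h3, hq, Real.sq_sqrt h2.le]
  positivity

theorem aux_alpha_le (ξ η : ℝ) (hξ : 0 < ξ) (hη : 0 ≤ η) (k : ℕ) : rabiAlpha ξ η k ≤ 1 := by
  unfold rabiAlpha
  split_ifs with h
  · exact zero_le_one
  have hk : (0 : ℝ) < (k : ℝ) := by exact_mod_cast Nat.pos_of_ne_zero h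
  have h1 : 0 < ξ * (k : ℝ) := mul_pos hξ hk
  have h2 : 0 < ξ * (k : ℝ) + η := by linarith
  rw [div_le_one h2]
  have := Real.sin_sq_le_one (Real.pi * Real.sqrt (ξ * k + η))
  nlinarith

theorem aux_pp (β ε : ℝ) : 0 < pPlus β ε := by unfold pPlus; positivity

theorem aux_pm (β ε : ℝ) : 0 < pMinus β ε := by unfold pMinus; positivity

theorem aux_sum (β ε : ℝ) : pMinus β ε + pPlus β ε = 1 := by
  unfold pPlus pMinus
  have : 0 < 1 + Real.exp (-(β * ε)) := by positivity
  field_simp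

theorem aux_nonneg (ε β ξ η : ℝ) (hξ : 0 < ξ) (hη : 0 ≤ η)
    (hnr : NonResonant ξ η) (k l : ℕ) : 0 ≤ bdKernel β ε ξ η k l := by
  have hp := aux_pp β ε
  have hm := aux_pm β ε
  have hs := aux_sum β ε
  have ha := aux_alpha_pos ξ η hξ hη hnr k
  have hb := aux_alpha_le ξ η hξ hη (k + 1)
  have hc := aux_alpha_le ξ η hξ hη k
  unfold bdKernel
  split_ifs with h1 h2 h3
  · positivity
  · subst h2
    have := aux_alpha_pos ξ η hξ hη hnr l
    positivity
  · nlinarith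
  · exact le_rfl

theorem aux_pow_nonneg (ε β ξ η : ℝ) (hξ : 0 < ξ) (hη : 0 ≤ η)
    (hnr : NonResonant ξ η) (t k l : ℕ) : 0 ≤ bdKernelPow β ε ξ η t k l := by
  induction t generalizing l with
  | zero => unfold bdKernelPow; split_ifs <;> norm_num
  | succ t ih =>
    unfold bdKernelPow
    exact tsum_nonneg fun j => mul_nonneg (ih j) (aux_nonneg ε β ξ η hξ hη hnr j l)

theorem aux_step (ε β ξ η : ℝ) (hξ : 0 < ξ) (hη : 0 ≤ η)
    (hnr : NonResonant ξ η) (t k j l : ℕ) (h : 0 < bdKernelPow β ε ξ η t k j)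
    (h' : 0 < bdKernel β ε ξ η j l) : 0 < bdKernelPow β ε ξ η (t + 1) k l := by
  rw [bdKernelPow]
  have hsum : Summable fun j : ℕ => bdKernelPow β ε ξ η t k j * bdKernel β ε ξ η j l := by
    apply summable_of_ne_finset_zero (s := Finset.range (l + 2))
    intro b hb
    rw [Finset.mem_range] at hb
    have : bdKernel β ε ξ η b l = 0 := by
      unfold bdKernel
      rw [if_neg (by omega), if_neg (by omega), if_neg (by omega)]
    rw [this, mul_zero]
  exact hsum.tsum_pos (fun i => mul_nonneg (aux_pow_nonneg ε β ξ η hξ hη hnr t k i)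
    (aux_nonneg ε β ξ η hξ hη hnr i l)) j (mul_pos h h')

/-- under the non-resonant condition the birth–death kernel is irreducible:
for all `k, ℓ` there is `t` with `p^t(k,ℓ) > 0`. -/
theorem statement1 (ε β ξ η : ℝ) (hε : 0 < ε) (hξ : 0 < ξ) (hη : 0 ≤ η)
    (hnr : NonResonant ξ η) :
    ∀ k l : ℕ, ∃ t : ℕ, 0 < bdKernelPow β ε ξ η t k l := by
  intro k l
  have up : ∀ j, 0 < bdKernel β ε ξ η j (j + 1) := by
    intro j
    unfold bdKernel
    rw [if_pos rfl]
    exact mul_pos (aux_pp β ε) (aux_alpha_pos ξ η hξ hη hnr j)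
  have down : ∀ j, 0 < bdKernel β ε ξ η (j + 1) j := by
    intro j
    unfold bdKernel
    rw [if_neg (by omega), if_pos rfl]
    exact mul_pos (aux_pm β ε) (aux_alpha_pos ξ η hξ hη hnr j)
  have h0 : 0 < bdKernelPow β ε ξ η 0 k k := by
    simp [bdKernelPow]
  rcases le_total k l with h | h
  · induction l, h using Nat.le_induction with
    | base => exact ⟨0, h0⟩
    | succ l _ ih =>
      obtain ⟨t, ht⟩ := ih
      exact ⟨t + 1, aux_step ε β ξ η hξ hη hnr t k l (l + 1) ht (up l)⟩
  · induction h using Nat.decreasingInduction with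
    | self => exact ⟨0, h0⟩
    | of_succ l _ ih =>
      obtain ⟨t, ht⟩ := ih
      exact ⟨t + 1, aux_step ε β ξ η hξ hη hnr t k (l + 1) l ht (down l)⟩
end

section
/- Assume the non-resonant condition holds and β > 0. Then μ_Gibbs is the unique invariant probability distribution of the birth–death kernel p: if ν : ℕ → ℝ satisfies ν(k) ≥ 0 for all k, ∑_{k∈ℕ} ν(k) = 1 and ∑_{k∈ℕ} ν(k)·p(k,ℓ) = ν(ℓ) for all ℓ ∈ ℕ, then ν = μ_Gibbs. (Part of Proposition 3.1.) -/
open MeasureTheory Filter Real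
open scoped ENNReal

lemma rabiAlpha_ne_zero (ξ η : ℝ) (hξ : 0 < ξ) (hη : 0 ≤ η) (hnr : NonResonant ξ η) (l : ℕ) :
    rabiAlpha ξ η (l + 1) ≠ 0 := by
  have h1 : 0 < ξ * ((l + 1 : ℕ) : ℝ) := by positivity
  have h2 : 0 < ξ * ((l + 1 : ℕ) : ℝ) + η := by linarith
  unfold rabiAlpha
  rw [if_neg (Nat.succ_ne_zero l)]
  refine div_ne_zero (mul_ne_zero (pow_ne_zero 2 ?_) h1.ne') h2.ne'
  intro h
  rw [Real.sin_eq_zero_iff] at h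
  obtain ⟨n, hn⟩ := h
  have hs : Real.sqrt (ξ * ((l + 1 : ℕ) : ℝ) + η) = n := by
    have := Real.pi_pos
    apply mul_left_cancel₀ this.ne'
    linarith
  refine hnr (l + 1) ⟨by omega, n.natAbs, ?_⟩
  rw [← Real.sq_sqrt h2.le, hs, Nat.cast_natAbs, Int.cast_abs, sq_abs]

/-- under the non-resonant condition and `β > 0`, `μ_Gibbs` is the unique
invariant probability distribution of the birth–death kernel. -/
theorem statement2 (ε β ξ η : ℝ) (hε : 0 < ε) (hβ : 0 < β) (hξ : 0 < ξ) (hη : 0 ≤ η)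
    (hnr : NonResonant ξ η) :
    ∀ ν : ℕ → ℝ, (∀ k, 0 ≤ ν k) → (∑' k : ℕ, ν k) = 1 →
      (∀ l : ℕ, (∑' k : ℕ, ν k * bdKernel β ε ξ η k l) = ν l) →
      ν = muGibbs β ε := by
  intro ν hν hsum hinv
  have hq0 : 0 < Real.exp (-(β * ε)) := Real.exp_pos _
  have hq1 : Real.exp (-(β * ε)) < 1 := by
    rw [Real.exp_lt_one_iff]
    have := mul_pos hβ hε
    linarith
  have hm : pMinus β ε ≠ 0 := by unfold pMinus; positivity
  have hp : pPlus β ε = Real.exp (-(β * ε)) * pMinus β ε := by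
    unfold pPlus pMinus; ring
  have hmu : ∀ k : ℕ, muGibbs β ε k
      = (1 - Real.exp (-(β * ε))) * Real.exp (-(β * ε)) ^ k := by
    intro k
    unfold muGibbs
    rw [← Real.exp_nat_mul]
    congr 2
    ring
  set q := Real.exp (-(β * ε)) with hq
  have h0 : ν 0 * (1 - pPlus β ε * rabiAlpha ξ η 1) + ν 1 * (pMinus β ε * rabiAlpha ξ η 1)
      = ν 0 := by
    have h := hinv 0
    rw [tsum_eq_sum (s := Finset.range 2)] at h
    · simpa [Finset.sum_range_succ, bdKernel, rabiAlpha] using h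
    · intro k hk
      simp only [Finset.mem_range, not_lt] at hk
      unfold bdKernel
      rw [if_neg (by omega), if_neg (by omega), if_neg (by omega), mul_zero]
  have hs : ∀ l : ℕ, ν l * (pPlus β ε * rabiAlpha ξ η (l + 1))
      + ν (l + 1) * (1 - pMinus β ε * rabiAlpha ξ η (l + 1) - pPlus β ε * rabiAlpha ξ η (l + 2))
      + ν (l + 2) * (pMinus β ε * rabiAlpha ξ η (l + 2)) = ν (l + 1) := by
    intro l
    have h := hinv (l + 1)
    rw [tsum_eq_sum (s := {l, l + 1, l + 2})] at h
    · rw [Finset.sum_insert (by simp), Finset.sum_insert (by simp), Finset.sum_singleton] at h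
      have e1 : bdKernel β ε ξ η l (l + 1) = pPlus β ε * rabiAlpha ξ η (l + 1) := by
        simp [bdKernel]
      have e2 : bdKernel β ε ξ η (l + 1) (l + 1) =
          1 - pMinus β ε * rabiAlpha ξ η (l + 1) - pPlus β ε * rabiAlpha ξ η (l + 2) := by
        simp [bdKernel]
      have e3 : bdKernel β ε ξ η (l + 2) (l + 1) = pMinus β ε * rabiAlpha ξ η (l + 2) := by
        simp [bdKernel]
      rw [e1, e2, e3] at h
      linarith
    · intro k hk
      simp only [Finset.mem_insert, Finset.mem_singleton, not_or] at hk
      unfold bdKernel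
      rw [if_neg (by omega), if_neg (by omega), if_neg (by omega), mul_zero]
  have hbal : ∀ l : ℕ, ν (l + 1) * (pMinus β ε * rabiAlpha ξ η (l + 1))
      = ν l * (pPlus β ε * rabiAlpha ξ η (l + 1)) := by
    intro l
    induction l with
    | zero => simp only [zero_add]; linarith
    | succ l ih => have := hs l; linarith
  have hrec : ∀ l : ℕ, ν (l + 1) = ν l * q := by
    intro l
    have h := hbal l
    rw [hp] at h
    apply mul_right_cancel₀ (mul_ne_zero hm (rabiAlpha_ne_zero ξ η hξ hη hnr l))
    linarith
  have hgeo : ∀ l : ℕ, ν l = ν 0 * q ^ l := by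
    intro l
    induction l with
    | zero => simp
    | succ l ih => rw [hrec, ih, pow_succ]; ring
  have hν0 : ν 0 = 1 - q := by
    rw [tsum_congr hgeo, tsum_mul_left, tsum_geometric_of_lt_one hq0.le hq1] at hsum
    have : 1 - q ≠ 0 := by linarith
    field_simp at hsum
    exact hsum
  funext k
  rw [hgeo, hmu, hν0]
end

section
/- Assume the non-resonant condition holds and β > 0. The birth–death chain is aperiodic and, for every probability distribution ν on ℕ and every k ∈ ℕ, lim_{t→∞} ∑_{j∈ℕ} ν(j)·p^t(j,k) = μ_Gibbs(k); in particular ν p^t converges weakly (equivalently, in total variation on the discrete space ℕ) to μ_Gibbs. (Part of Proposition 3.1.) -/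
open MeasureTheory Filter Real
open scoped ENNReal

namespace BD

open Filter Topology

def L (A B : ℕ → ℝ) (f : ℕ → ℝ) (k : ℕ) : ℝ :=
  A k * f (k - 1) + B k * f (k + 1) + (1 - A k - B k) * f k

structure Good (A B μ : ℕ → ℝ) : Prop where
  A0 : A 0 = 0
  Apos : ∀ k, 0 < A (k + 1)
  Bpos : ∀ k, 0 < B k
  le1 : ∀ k, A k + B k ≤ 1
  lt0 : B 0 < 1
  mpos : ∀ k, 0 < μ k
  msum : HasSum μ 1
  bal : ∀ k, μ k * B k = μ (k + 1) * A (k + 1)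

variable {A B μ : ℕ → ℝ}

lemma Good.Ann (h : Good A B μ) (k : ℕ) : 0 ≤ A k := by
  cases k with
  | zero => exact h.A0.ge
  | succ k => exact (h.Apos k).le

lemma L_nonneg (h : Good A B μ) {f : ℕ → ℝ} (hf : ∀ k, 0 ≤ f k) (k : ℕ) : 0 ≤ L A B f k := by
  have h1 := mul_nonneg (h.Ann k) (hf (k - 1))
  have h2 := mul_nonneg (h.Bpos k).le (hf (k + 1))
  have h3 := mul_nonneg (by linarith [h.le1 k] : 0 ≤ 1 - A k - B k) (hf k)
  unfold L; linarith

lemma L_le (h : Good A B μ) {f : ℕ → ℝ} {C : ℝ} (hf : ∀ k, f k ≤ C) (k : ℕ) : L A B f k ≤ C := by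
  have h1 := mul_le_mul_of_nonneg_left (hf (k - 1)) (h.Ann k)
  have h2 := mul_le_mul_of_nonneg_left (hf (k + 1)) (h.Bpos k).le
  have h3 := mul_le_mul_of_nonneg_left (hf k) (by linarith [h.le1 k] : 0 ≤ 1 - A k - B k)
  unfold L; nlinarith

lemma smul_bdd (h : Good A B μ) {g : ℕ → ℝ} {C : ℝ} (h0 : ∀ k, 0 ≤ g k) (hC : ∀ k, g k ≤ C) :
    Summable (fun k => μ k * g k) := by
  refine Summable.of_nonneg_of_le (fun k => mul_nonneg (h.mpos k).le (h0 k)) (fun k => ?_)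
    (h.msum.summable.mul_right C)
  exact mul_le_mul_of_nonneg_left (hC k) (h.mpos k).le

lemma inv (h : Good A B μ) {f : ℕ → ℝ} {C : ℝ} (h0 : ∀ k, 0 ≤ f k) (hC : ∀ k, f k ≤ C) :
    ∑' k, μ k * L A B f k = ∑' k, μ k * f k := by
  have A1 : ∀ k, A k ≤ 1 := fun k => by linarith [h.le1 k, h.Bpos k]
  have B1 : ∀ k, B k ≤ 1 := fun k => by linarith [h.le1 k, h.Ann k]
  have C0 : 0 ≤ C := (h0 0).trans (hC 0)
  have aux : ∀ (X : ℕ → ℝ) (g : ℕ → ℕ), (∀ k, 0 ≤ X k) → (∀ k, X k ≤ 1) →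
      Summable (fun k => μ k * (X k * f (g k))) := by
    intro X g hx hx1
    refine smul_bdd (C := C) h (fun k => mul_nonneg (hx k) (h0 _)) (fun k => ?_)
    have := mul_le_mul (hx1 k) (hC (g k)) (h0 _) zero_le_one
    linarith
  have s1 := aux A (fun k => k - 1) h.Ann A1
  have s2 := aux B (fun k => k + 1) (fun k => (h.Bpos k).le) B1
  have s3 := aux A (fun k => k) h.Ann A1
  have s4 := aux B (fun k => k) (fun k => (h.Bpos k).le) B1
  have s5 := smul_bdd h h0 hC
  have e1 : ∑' k, μ k * (A k * f (k - 1)) = ∑' k, μ k * (B k * f k) := by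
    rw [s1.tsum_eq_zero_add]
    simp only [h.A0, zero_mul, mul_zero, zero_add, Nat.add_sub_cancel]
    refine tsum_congr fun k => ?_
    rw [← mul_assoc, ← mul_assoc, h.bal]
  have e2 : ∑' k, μ k * (A k * f k) = ∑' k, μ k * (B k * f (k + 1)) := by
    rw [s3.tsum_eq_zero_add]
    simp only [h.A0, zero_mul, mul_zero, zero_add]
    refine tsum_congr fun k => ?_
    rw [← mul_assoc, ← mul_assoc, h.bal]
  have : ∀ k, μ k * L A B f k = (μ k * (A k * f (k - 1)) + μ k * (B k * f (k + 1)))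
      + (μ k * f k - μ k * (A k * f k) - μ k * (B k * f k)) := by
    intro k; unfold L; ring
  simp_rw [this]
  rw [(s1.add s2).tsum_add ((s5.sub s3).sub s4), s1.tsum_add s2, (s5.sub s3).tsum_sub s4,
    s5.tsum_sub s3, e1, e2]
  ring

def V (A B f : ℕ → ℝ) (k : ℕ) : ℝ := L A B (fun j => f j ^ 2) k - L A B f k ^ 2

lemma V_eq (f : ℕ → ℝ) (k : ℕ) : V A B f k = A k * B k * (f (k - 1) - f (k + 1)) ^ 2
    + A k * (1 - A k - B k) * (f (k - 1) - f k) ^ 2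
    + B k * (1 - A k - B k) * (f (k + 1) - f k) ^ 2 := by
  unfold V L; ring

lemma V_nonneg (h : Good A B μ) (f : ℕ → ℝ) (k : ℕ) : 0 ≤ V A B f k := by
  rw [V_eq]
  have h1 := h.Ann k
  have h2 := (h.Bpos k).le
  have h3 : 0 ≤ 1 - A k - B k := by linarith [h.le1 k]
  positivity

lemma bounds (h : Good A B μ) {u : ℕ → ℕ → ℝ} (hu : ∀ t k, u (t + 1) k = L A B (u t) k)
    {C : ℝ} (h0 : ∀ k, 0 ≤ u 0 k) (hC : ∀ k, u 0 k ≤ C) (t : ℕ) :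
    (∀ k, 0 ≤ u t k) ∧ (∀ k, u t k ≤ C) := by
  induction t with
  | zero => exact ⟨h0, hC⟩
  | succ t ih =>
    exact ⟨fun k => by rw [hu]; exact L_nonneg h ih.1 k, fun k => by rw [hu]; exact L_le h ih.2 k⟩

lemma mass (h : Good A B μ) {u : ℕ → ℕ → ℝ} (hu : ∀ t k, u (t + 1) k = L A B (u t) k)
    {C : ℝ} (h0 : ∀ k, 0 ≤ u 0 k) (hC : ∀ k, u 0 k ≤ C) (t : ℕ) :
    ∑' k, μ k * u t k = ∑' k, μ k * u 0 k := by
  induction t with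
  | zero => rfl
  | succ t ih =>
    obtain ⟨h1, h2⟩ := bounds h hu h0 hC t
    simp_rw [hu]
    rw [inv h h1 h2, ih]

lemma V_tendsto (h : Good A B μ) {u : ℕ → ℕ → ℝ} (hu : ∀ t k, u (t + 1) k = L A B (u t) k)
    {C : ℝ} (h0 : ∀ k, 0 ≤ u 0 k) (hC : ∀ k, u 0 k ≤ C) (k : ℕ) :
    Tendsto (fun t => V A B (u t) k) atTop (𝓝 0) := by
  have hb := bounds h hu h0 hC
  have sq0 : ∀ t k, 0 ≤ u t k ^ 2 := fun t k => sq_nonneg _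
  have sqC : ∀ t k, u t k ^ 2 ≤ C ^ 2 := fun t k => pow_le_pow_left₀ ((hb t).1 k) ((hb t).2 k) 2
  have S : ∀ t, Summable (fun k => μ k * u t k ^ 2) := fun t => smul_bdd h (sq0 t) (sqC t)
  have SL : ∀ t, Summable (fun k => μ k * L A B (fun j => u t j ^ 2) k) := fun t =>
    smul_bdd h (L_nonneg h (sq0 t)) (L_le h (sqC t))
  set D : ℕ → ℝ := fun t => ∑' k, μ k * u t k ^ 2 with hD
  have key : ∀ t, D t - D (t + 1) = ∑' k, μ k * V A B (u t) k := by
    intro t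
    simp only [hD]
    rw [← inv h (sq0 t) (sqC t), ← (SL t).tsum_sub (S (t + 1))]
    refine tsum_congr fun k => ?_
    rw [hu]; unfold V; ring
  have SV : ∀ t, Summable (fun k => μ k * V A B (u t) k) := by
    intro t
    refine ((SL t).sub (S (t + 1))).congr fun k => ?_
    rw [hu]; unfold V; ring
  have nn : ∀ t k, 0 ≤ μ k * V A B (u t) k := fun t k => mul_nonneg (h.mpos k).le (V_nonneg h _ k)
  have hle : ∀ t, μ k * V A B (u t) k ≤ D t - D (t + 1) := by
    intro t
    rw [key]
    exact (SV t).le_tsum k (fun j _ => nn t j)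
  have anti : Antitone D := antitone_nat_of_succ_le fun t => by linarith [hle t, nn t k]
  have bdd : BddBelow (Set.range D) := by
    refine ⟨0, ?_⟩
    rintro _ ⟨t, rfl⟩
    exact tsum_nonneg fun k => mul_nonneg (h.mpos k).le (sq0 t k)
  have lim := tendsto_atTop_ciInf anti bdd
  have lim2 := lim.sub (lim.comp (tendsto_add_atTop_nat 1))
  rw [sub_self] at lim2
  have lim3 : Tendsto (fun t => μ k * V A B (u t) k) atTop (𝓝 0) :=
    squeeze_zero (fun t => nn t k) hle lim2
  have := lim3.const_mul (μ k)⁻¹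
  rw [mul_zero] at this
  refine this.congr fun t => ?_
  rw [inv_mul_cancel_left₀ (h.mpos k).ne']

lemma of_sq {c : ℝ} (hc : 0 < c) {v f : ℕ → ℝ} (hv : Tendsto v atTop (𝓝 0))
    (hle : ∀ t, c * f t ^ 2 ≤ v t) : Tendsto f atTop (𝓝 0) := by
  have h1 : Tendsto (fun t => c * f t ^ 2) atTop (𝓝 0) :=
    squeeze_zero (fun t => by positivity) hle hv
  have h2 := h1.const_mul c⁻¹
  rw [mul_zero] at h2
  have h3 : Tendsto (fun t => f t ^ 2) atTop (𝓝 0) := by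
    refine h2.congr fun t => ?_
    rw [inv_mul_cancel_left₀ hc.ne']
  have h4 := h3.sqrt
  rw [Real.sqrt_zero] at h4
  simp_rw [Real.sqrt_sq_eq_abs] at h4
  exact (tendsto_zero_iff_abs_tendsto_zero _).2 h4

lemma diff_tendsto (h : Good A B μ) {u : ℕ → ℕ → ℝ} (hu : ∀ t k, u (t + 1) k = L A B (u t) k)
    {C : ℝ} (h0 : ∀ k, 0 ≤ u 0 k) (hC : ∀ k, u 0 k ≤ C) (k : ℕ) :
    Tendsto (fun t => u t k - u t 0) atTop (𝓝 0) ∧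
    Tendsto (fun t => u t (k + 1) - u t 0) atTop (𝓝 0) := by
  induction k with
  | zero =>
    refine ⟨by simp, ?_⟩
    refine of_sq (c := B 0 * (1 - B 0)) (mul_pos (h.Bpos 0) (by linarith [h.lt0]))
      (V_tendsto h hu h0 hC 0) fun t => ?_
    rw [V_eq, h.A0]; apply le_of_eq; ring_nf
  | succ k ih =>
    refine ⟨ih.2, ?_⟩
    have : Tendsto (fun t => u t k - u t (k + 2)) atTop (𝓝 0) := by
      refine of_sq (c := A (k + 1) * B (k + 1)) (mul_pos (h.Apos k) (h.Bpos _))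
        (V_tendsto h hu h0 hC (k + 1)) fun t => ?_
      rw [V_eq]
      have h1 := (h.Apos k).le
      have h2 := (h.Bpos (k + 1)).le
      have h3 : 0 ≤ 1 - A (k + 1) - B (k + 1) := by linarith [h.le1 (k + 1)]
      simp only [Nat.add_sub_cancel]
      have h4 := mul_nonneg (mul_nonneg h1 h3) (sq_nonneg (u t k - u t (k + 1)))
      have h5 := mul_nonneg (mul_nonneg h2 h3) (sq_nonneg (u t (k + 1 + 1) - u t (k + 1)))
      linarith
    have := ih.1.sub this
    rw [sub_zero] at this
    refine this.congr fun t => ?_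
    ring_nf

lemma conv (h : Good A B μ) {u : ℕ → ℕ → ℝ} (hu : ∀ t k, u (t + 1) k = L A B (u t) k)
    {C : ℝ} (h0 : ∀ k, 0 ≤ u 0 k) (hC : ∀ k, u 0 k ≤ C) (k : ℕ) :
    Tendsto (fun t => u t k) atTop (𝓝 (∑' j, μ j * u 0 j)) := by
  have hb := bounds h hu h0 hC
  have d := fun k => (diff_tendsto h hu h0 hC k).1
  have T : Tendsto (fun t => ∑' k, μ k * (u t k - u t 0)) atTop (𝓝 (∑' k : ℕ, (0 : ℝ))) := by
    refine tendsto_tsum_of_dominated_convergence (h.msum.summable.mul_right C) (fun k => ?_)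
      (Eventually.of_forall fun t k => ?_)
    · simpa using (d k).const_mul (μ k)
    · rw [norm_mul, Real.norm_of_nonneg (h.mpos k).le]
      refine mul_le_mul_of_nonneg_left ?_ (h.mpos k).le
      rw [Real.norm_eq_abs, abs_le]
      constructor <;> linarith [(hb t).1 k, (hb t).2 k, (hb t).1 0, (hb t).2 0]
  rw [tsum_zero] at T
  have E : ∀ t, ∑' k, μ k * (u t k - u t 0) = (∑' j, μ j * u 0 j) - u t 0 := by
    intro t
    simp_rw [mul_sub]
    rw [(smul_bdd h (hb t).1 (hb t).2).tsum_sub (h.msum.summable.mul_right _), tsum_mul_right,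
      h.msum.tsum_eq, one_mul, mass h hu h0 hC]
  simp_rw [E] at T
  have := (d k).add ((tendsto_const_nhds (x := ∑' j, μ j * u 0 j)).sub T)
  simp only [zero_add, sub_zero] at this
  refine this.congr fun t => ?_
  ring

/-- Kernel powers. -/
lemma kernel (h : Good A B μ) {P : ℕ → ℕ → ℕ → ℝ}
    (P0 : ∀ k l, P 0 k l = if k = l then 1 else 0)
    (PS : ∀ t k l, μ l * L A B (fun j => P t k j / μ j) l = P (t + 1) k l) (k : ℕ) :
    (∀ t l, 0 ≤ P t k l) ∧ (∀ t, HasSum (P t k) 1) ∧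
    (∀ l, Tendsto (fun t => P t k l) atTop (𝓝 (μ l))) := by
  set u : ℕ → ℕ → ℝ := fun t l => P t k l / μ l with hudef
  have hP : ∀ t l, μ l * u t l = P t k l := fun t l => by
    simp only [hudef]; exact mul_div_cancel₀ _ (h.mpos l).ne'
  have hu : ∀ t l, u (t + 1) l = L A B (u t) l := by
    intro t l
    have := PS t k l
    rw [← hP] at this
    exact (mul_left_cancel₀ (h.mpos l).ne' this).symm
  have h0 : ∀ l, 0 ≤ u 0 l := fun l => by
    simp only [hudef, P0]
    have := h.mpos l
    split_ifs <;> positivity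
  have hC : ∀ l, u 0 l ≤ 1 / μ k := fun l => by
    simp only [hudef, P0]
    have := h.mpos k
    split_ifs with hkl
    · rw [hkl]
    · rw [zero_div]; positivity
  have m0 : ∑' l, μ l * u 0 l = 1 := by
    simp_rw [hP, P0]
    simp
  refine ⟨fun t l => ?_, fun t => ?_, fun l => ?_⟩
  · rw [← hP]; exact mul_nonneg (h.mpos l).le ((bounds h hu h0 hC t).1 l)
  · have s := (smul_bdd h (bounds h hu h0 hC t).1 (bounds h hu h0 hC t).2).hasSum
    rw [mass h hu h0 hC, m0] at s
    simpa only [hP] using s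
  · have := (conv h hu h0 hC l).const_mul (μ l)
    rw [m0, mul_one] at this
    simpa only [hP] using this

lemma final (h : Good A B μ) {P : ℕ → ℕ → ℕ → ℝ}
    (P0 : ∀ k l, P 0 k l = if k = l then 1 else 0)
    (PS : ∀ t k l, μ l * L A B (fun j => P t k j / μ j) l = P (t + 1) k l) :
    (∀ k d : ℕ, (∀ t : ℕ, 1 ≤ t → 0 < P t k k → d ∣ t) → d = 1) ∧
    (∀ ν : ℕ → ℝ, (∀ j, 0 ≤ ν j) → (∑' j : ℕ, ν j) = 1 →
      (∀ k : ℕ, Tendsto (fun t : ℕ => ∑' j : ℕ, ν j * P t j k) atTop (𝓝 (μ k))) ∧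
      Tendsto (fun t : ℕ => ∑' k : ℕ, |(∑' j : ℕ, ν j * P t j k) - μ k|) atTop (𝓝 0)) := by
  have K := kernel h P0 PS
  have Ple : ∀ t j k, P t j k ≤ 1 := fun t j k =>
    le_hasSum ((K j).2.1 t) k (fun l _ => (K j).1 t l)
  constructor
  · intro k d hd
    have ev := ((K k).2.2 k).eventually (lt_mem_nhds (h.mpos k))
    obtain ⟨N, hN⟩ := eventually_atTop.1 ev
    have h1 := hd (N + 1) (by omega) (hN _ (by omega))
    have h2 := hd (N + 2) (by omega) (hN _ (by omega))
    have := (Nat.dvd_sub h2 h1)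
    rw [show N + 2 - (N + 1) = 1 by omega] at this
    exact Nat.dvd_one.1 this
  · intro ν ν0 ν1
    have νs : Summable ν := by
      by_contra hc
      rw [tsum_eq_zero_of_not_summable hc] at ν1
      exact zero_ne_one ν1
    have pt : ∀ k : ℕ, Tendsto (fun t : ℕ => ∑' j : ℕ, ν j * P t j k) atTop (𝓝 (μ k)) := by
      intro k
      have : Tendsto (fun t : ℕ => ∑' j : ℕ, ν j * P t j k) atTop (𝓝 (∑' j, ν j * μ k)) := by
        refine tendsto_tsum_of_dominated_convergence νs (fun j => ((K j).2.2 k).const_mul _)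
          (Eventually.of_forall fun t j => ?_)
        rw [Real.norm_of_nonneg (mul_nonneg (ν0 j) ((K j).1 t k))]
        exact mul_le_of_le_one_right (ν0 j) (Ple t j k)
      rwa [tsum_mul_right, ν1, one_mul] at this
    refine ⟨pt, ?_⟩
    set q : ℕ → ℕ → ℝ := fun t k => ∑' j, ν j * P t j k with hq
    have qs : ∀ t, HasSum (q t) 1 := by
      intro t
      have S : Summable (fun x : ℕ × ℕ => ν x.1 * P t x.1 x.2) := by
        have nn : (0 : ℕ × ℕ → ℝ) ≤ fun x : ℕ × ℕ => ν x.1 * P t x.1 x.2 :=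
          fun x => mul_nonneg (ν0 x.1) ((K x.1).1 t x.2)
        refine (summable_prod_of_nonneg nn).2 ⟨fun j => ?_, ?_⟩
        · exact Summable.mul_left (ν j) ((K j).2.1 t).summable
        · have e : (fun j => ∑' k, ν j * P t j k) = ν := by
            funext j
            rw [tsum_mul_left, ((K j).2.1 t).tsum_eq, mul_one]
          exact e.symm ▸ νs
      have S2 := S.prod_symm
      have e : ∑' k, q t k = 1 := by
        simp only [hq]
        rw [Summable.tsum_comm (f := fun j k => ν j * P t j k) S]
        rw [← ν1]
        refine tsum_congr fun j => ?_
        rw [tsum_mul_left, ((K j).2.1 t).tsum_eq, mul_one]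
      have s : Summable (q t) := S2.prod
      rw [← e]; exact s.hasSum
    have q0 : ∀ t k, 0 ≤ q t k := fun t k => tsum_nonneg fun j => mul_nonneg (ν0 j) ((K j).1 t k)
    have hm : ∀ t k, ‖max (μ k - q t k) 0‖ ≤ μ k := by
      intro t k
      rw [Real.norm_of_nonneg (le_max_right _ _)]
      exact max_le (by linarith [q0 t k]) (h.mpos k).le
    have T : Tendsto (fun t => ∑' k, max (μ k - q t k) 0) atTop (𝓝 (∑' k : ℕ, (0 : ℝ))) := by
      refine tendsto_tsum_of_dominated_convergence h.msum.summable (fun k => ?_)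
        (Eventually.of_forall fun t k => hm t k)
      have := ((tendsto_const_nhds (x := μ k)).sub (pt k)).max (tendsto_const_nhds (x := (0 : ℝ)))
      simpa using this
    rw [tsum_zero] at T
    have T2 := T.const_mul 2
    rw [mul_zero] at T2
    refine T2.congr fun t => ?_
    have sm : Summable (fun k => max (μ k - q t k) 0) :=
      Summable.of_norm_bounded h.msum.summable (hm t)
    have e : ∀ k, |q t k - μ k| = (q t k - μ k) + 2 * max (μ k - q t k) 0 := by
      intro k
      rcases le_total (q t k) (μ k) with hh | hh
      · rw [abs_of_nonpos (by linarith), max_eq_left (by linarith)]; ring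
      · rw [abs_of_nonneg (by linarith), max_eq_right (by linarith)]; ring
    have e' : ∑' k, |q t k - μ k| = ∑' k, ((q t k - μ k) + 2 * max (μ k - q t k) 0) :=
      tsum_congr e
    refine Eq.trans ?_ e'.symm
    rw [((qs t).summable.sub h.msum.summable).tsum_add (sm.mul_left 2),
      (qs t).summable.tsum_sub h.msum.summable, (qs t).tsum_eq, h.msum.tsum_eq, tsum_mul_left]
    ring

end BD

lemma rabi_pos {ξ η : ℝ} (hξ : 0 < ξ) (hη : 0 ≤ η) (hnr : NonResonant ξ η) (k : ℕ) :
    0 < rabiAlpha ξ η (k + 1) := by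
  unfold rabiAlpha
  rw [if_neg (Nat.succ_ne_zero k)]
  have hk : 0 < ξ * ((k + 1 : ℕ) : ℝ) := by positivity
  have hs : Real.sin (Real.pi * Real.sqrt (ξ * ((k + 1 : ℕ) : ℝ) + η)) ≠ 0 := by
    intro h0
    obtain ⟨n, hn⟩ := Real.sin_eq_zero_iff.1 h0
    rw [mul_comm] at hn
    have hn' := mul_left_cancel₀ Real.pi_ne_zero hn
    refine hnr (k + 1) ⟨by omega, n.natAbs, ?_⟩
    rw [Nat.cast_natAbs, Int.cast_abs, sq_abs, hn', Real.sq_sqrt (by positivity)]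
  have := pow_pos (abs_pos.2 hs) 2
  rw [sq_abs] at this
  positivity

lemma rabi_le {ξ η : ℝ} (hξ : 0 < ξ) (hη : 0 ≤ η) (k : ℕ) : rabiAlpha ξ η k ≤ 1 := by
  unfold rabiAlpha
  split_ifs with h
  · exact zero_le_one
  · have hk : 0 < ξ * (k : ℝ) := by
      have : (0 : ℝ) < k := by exact_mod_cast Nat.pos_of_ne_zero h
      positivity
    rw [div_le_one (by positivity)]
    have := mul_le_mul_of_nonneg_right (Real.sin_sq_le_one (Real.pi * Real.sqrt (ξ * k + η))) hk.le
    linarith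

lemma muGibbs_eq (β ε : ℝ) (k : ℕ) :
    muGibbs β ε k = (1 - Real.exp (-(β * ε))) * Real.exp (-(β * ε)) ^ k := by
  unfold muGibbs
  rw [← Real.exp_nat_mul]; congr 2; ring

lemma good_chain {ε β ξ η : ℝ} (hε : 0 < ε) (hβ : 0 < β) (hξ : 0 < ξ) (hη : 0 ≤ η)
    (hnr : NonResonant ξ η) :
    BD.Good (fun k => pMinus β ε * rabiAlpha ξ η k) (fun k => pPlus β ε * rabiAlpha ξ η (k + 1))
      (muGibbs β ε) := by
  have hq0 : 0 < Real.exp (-(β * ε)) := Real.exp_pos _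
  have hq1 : Real.exp (-(β * ε)) < 1 := by
    rw [Real.exp_lt_one_iff]; have := mul_pos hβ hε; linarith
  have hm : 0 < pMinus β ε := by unfold pMinus; positivity
  have hp : 0 < pPlus β ε := by unfold pPlus; positivity
  have hs : pMinus β ε + pPlus β ε = 1 := by unfold pMinus pPlus; field_simp
  have hr : pPlus β ε = Real.exp (-(β * ε)) * pMinus β ε := by unfold pMinus pPlus; ring
  refine ⟨by simp [rabiAlpha], fun k => mul_pos hm (rabi_pos hξ hη hnr k),
    fun k => mul_pos hp (rabi_pos hξ hη hnr k), fun k => ?_, ?_, fun k => ?_, ?_, fun k => ?_⟩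
  · have h1 := mul_le_mul_of_nonneg_left (rabi_le hξ hη k) hm.le
    have h2 := mul_le_mul_of_nonneg_left (rabi_le hξ hη (k + 1)) hp.le
    linarith
  · have h2 := mul_le_mul_of_nonneg_left (rabi_le hξ hη (0 + 1)) hp.le
    linarith
  · rw [muGibbs_eq]; exact mul_pos (by linarith) (pow_pos hq0 k)
  · have := (hasSum_geometric_of_lt_one hq0.le hq1).mul_left (1 - Real.exp (-(β * ε)))
    rw [mul_inv_cancel₀ (by linarith)] at this
    exact this.congr_fun (muGibbs_eq β ε)
  · simp only [muGibbs_eq, hr]; ring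

lemma pow_succ_eq {ε β ξ η : ℝ} {A B μ : ℕ → ℝ}
    (hA : A = fun k => pMinus β ε * rabiAlpha ξ η k)
    (hB : B = fun k => pPlus β ε * rabiAlpha ξ η (k + 1)) (h : BD.Good A B μ) (t k l : ℕ) :
    μ l * BD.L A B (fun j => bdKernelPow β ε ξ η t k j / μ j) l = bdKernelPow β ε ξ η (t + 1) k l := by
  have hup : ∀ j, bdKernel β ε ξ η j (j + 1) = B j := fun j => by simp [bdKernel, hB]
  have hdn : ∀ j, bdKernel β ε ξ η (j + 1) j = A (j + 1) := fun j => by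
    have : j ≠ j + 1 + 1 := by omega
    simp [bdKernel, hA, this]
  have hdg : ∀ j, bdKernel β ε ξ η j j = 1 - A j - B j := fun j => by simp [bdKernel, hA, hB]
  have hz : ∀ j l, l ≠ j + 1 → l + 1 ≠ j → l ≠ j → bdKernel β ε ξ η j l = 0 := by
    intro j l h1 h2 h3
    simp [bdKernel, h1, h2, h3]
  rw [bdKernelPow]
  set p := bdKernelPow β ε ξ η t k
  have hne := fun j => (h.mpos j).ne'
  cases l with
  | zero =>
    rw [tsum_eq_sum (s := {0, 1}), Finset.sum_pair (by simp), hdg, hdn 0]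
    · have b := h.bal 0
      have n0 := hne 0
      have n1 := hne 1
      simp only [BD.L, h.A0]
      simp only [zero_add] at b ⊢
      have : A 1 = μ 0 * B 0 / μ 1 := by rw [b]; field_simp
      rw [this]
      field_simp
      ring
    · intro j hj
      simp only [Finset.mem_insert, Finset.mem_singleton, not_or] at hj
      rw [hz j 0 (by omega) (by omega) (by omega), mul_zero]
  | succ m =>
    rw [tsum_eq_sum (s := {m, m + 1, m + 2}), Finset.sum_insert (by simp), Finset.sum_pair (by simp),
      hdg, hdn (m + 1), hup]
    · have b := h.bal m
      have b1 := h.bal (m + 1)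
      have n0 := hne m
      have n1 := hne (m + 1)
      have n2 := hne (m + 1 + 1)
      simp only [BD.L, Nat.add_sub_cancel]
      have e1 : A (m + 1 + 1) = μ (m + 1) * B (m + 1) / μ (m + 1 + 1) := by rw [b1]; field_simp
      have e2 : B m = μ (m + 1) * A (m + 1) / μ m := by rw [← b]; field_simp
      rw [e1, e2, show m + 2 = m + 1 + 1 from rfl]
      field_simp
      ring
    · intro j hj
      simp only [Finset.mem_insert, Finset.mem_singleton, not_or] at hj
      rw [hz j (m + 1) (by omega) (by omega) (by omega), mul_zero]

/-- under the non-resonant condition and `β > 0`, the birth–death chain is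
aperiodic (every common divisor of the return times of any state is `1`) and for every
probability distribution `ν` on `ℕ`, `ν p^t` converges pointwise to `μ_Gibbs`, and in
total variation. -/
theorem statement3 (ε β ξ η : ℝ) (hε : 0 < ε) (hβ : 0 < β) (hξ : 0 < ξ) (hη : 0 ≤ η)
    (hnr : NonResonant ξ η) :
    (∀ k d : ℕ, (∀ t : ℕ, 1 ≤ t → 0 < bdKernelPow β ε ξ η t k k → d ∣ t) → d = 1) ∧
    (∀ ν : ℕ → ℝ, (∀ j, 0 ≤ ν j) → (∑' j : ℕ, ν j) = 1 →
      (∀ k : ℕ, Filter.Tendsto (fun t : ℕ => ∑' j : ℕ, ν j * bdKernelPow β ε ξ η t j k)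
        Filter.atTop (nhds (muGibbs β ε k))) ∧
      Filter.Tendsto
        (fun t : ℕ => ∑' k : ℕ, |(∑' j : ℕ, ν j * bdKernelPow β ε ξ η t j k) - muGibbs β ε k|)
        Filter.atTop (nhds 0)) := by
  exact BD.final (good_chain hε hβ hξ hη hnr) (fun k l => rfl)
    (fun t k l => pow_succ_eq rfl rfl (good_chain hε hβ hξ hη hnr) t k l)
end

section
/- Assume the non-resonant condition holds and β > 0. For every k ∈ ℕ, ℙᵏ(A_k) = 1, where A_k = {ω ∈ Ω : N_t(k,ω) = k for infinitely many t ∈ ℕ}. (Recurrence of the Fock-state quantum trajectory; key step in Proposition 4.2.) -/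
open MeasureTheory Filter Real
open scoped ENNReal

namespace RabiAux

lemma measurableSet_out (s : Set Outcome) : MeasurableSet s := trivial

instance : Fintype Outcome :=
  ⟨{Outcome.mm, Outcome.mp, Outcome.pm, Outcome.pp}, by intro x; cases x <;> simp⟩

lemma ms0 (a : Outcome) : MeasurableSet {ω : ℕ → Outcome | ω 0 = a} := by
  have h : Measurable (fun ω : ℕ → Outcome => ω 0) := measurable_pi_apply 0
  have h2 := h (measurableSet_out {a})
  have e : (fun ω : ℕ → Outcome => ω 0) ⁻¹' {a} = {ω : ℕ → Outcome | ω 0 = a} := by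
    ext ω; simp
  rwa [e] at h2

def sh (ω : ℕ → Outcome) : ℕ → Outcome := fun n => ω (n + 1)

lemma measurable_sh : Measurable sh :=
  measurable_pi_lambda _ fun n => measurable_pi_apply (n + 1)

lemma mem_cyl_cons (a : Outcome) (w : List Outcome) (ω : ℕ → Outcome) :
    ω ∈ cylinder (a :: w) ↔ ω 0 = a ∧ sh ω ∈ cylinder w := by
  simp only [_root_.cylinder, Set.mem_ofPred_eq, sh]
  constructor
  · intro h
    refine ⟨h ⟨0, by simp⟩, fun i => ?_⟩
    exact h ⟨i.1 + 1, by simp⟩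
  · rintro ⟨h0, h⟩ ⟨i, hi⟩
    cases i with
    | zero => exact h0
    | succ n => exact h ⟨n, by simpa using hi⟩

lemma cyl_nil : cylinder [] = Set.univ := by
  ext ω; simp [_root_.cylinder]

lemma measurableSet_cyl (w : List Outcome) : MeasurableSet (cylinder w) := by
  have : cylinder w = ⋂ i : Fin w.length, (fun ω : ℕ → Outcome => ω i) ⁻¹' {w.get i} := by
    ext ω; simp [_root_.cylinder]
  rw [this]
  exact MeasurableSet.iInter fun i => measurable_pi_apply _ (measurableSet_out _)

lemma pi_cyl : IsPiSystem (Set.range cylinder) := by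
  have key : ∀ w w' : List Outcome, w.length ≤ w'.length →
      (cylinder w ∩ cylinder w').Nonempty → cylinder w' ⊆ cylinder w := by
    rintro w w' hl ⟨ω, h1, h2⟩ ω' h3 i
    have e1 := h1 i
    have e2 := h2 ⟨i.1, by omega⟩
    have e3 := h3 ⟨i.1, by omega⟩
    rw [← e1]
    exact e3.trans e2.symm
  rintro _ ⟨w, rfl⟩ _ ⟨w', rfl⟩ hne
  rcases le_total w.length w'.length with hl | hl
  · exact ⟨w', (Set.inter_eq_right.2 (key w w' hl hne)).symm⟩
  · rw [Set.inter_comm] at hne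
    exact ⟨w, (Set.inter_eq_left.2 (key w' w hl hne)).symm⟩

lemma gen_cyl : (MeasurableSpace.pi : MeasurableSpace (ℕ → Outcome)) =
    MeasurableSpace.generateFrom (Set.range cylinder) := by
  apply le_antisymm
  · refine iSup_le fun i => ?_
    rintro _ ⟨s, -, rfl⟩
    have : (fun ω : ℕ → Outcome => ω i) ⁻¹' s =
        ⋃ w ∈ {w : List Outcome | ∃ h : i < w.length, w.get ⟨i, h⟩ ∈ s}, cylinder w := by
      ext ω
      simp only [Set.mem_preimage, Set.mem_iUnion, Set.mem_ofPred_eq]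
      constructor
      · intro h
        refine ⟨List.ofFn (fun j : Fin (i + 1) => ω j), ⟨by simp, by simpa [-List.ofFn_succ] using h⟩, ?_⟩
        intro j
        simp [-List.ofFn_succ]
      · rintro ⟨w, ⟨h, hs⟩, hw⟩
        have := hw ⟨i, h⟩
        rw [← this] at hs
        exact hs
    rw [this]
    exact MeasurableSet.biUnion (Set.to_countable _)
      fun w _ => MeasurableSpace.measurableSet_generateFrom ⟨w, rfl⟩
  · apply MeasurableSpace.generateFrom_le
    rintro _ ⟨w, rfl⟩
    exact measurableSet_cyl w

lemma pM_nonneg (β ε : ℝ) : 0 ≤ pMinus β ε := by unfold pMinus; positivity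
lemma pP_nonneg (β ε : ℝ) : 0 ≤ pPlus β ε := by unfold pPlus; positivity

lemma al_nonneg {ξ η : ℝ} (hξ : 0 < ξ) (hη : 0 ≤ η) (k : ℕ) : 0 ≤ rabiAlpha ξ η k := by
  unfold rabiAlpha; split_ifs <;> positivity

lemma al_le {ξ η : ℝ} (hξ : 0 < ξ) (hη : 0 ≤ η) (k : ℕ) : rabiAlpha ξ η k ≤ 1 := by
  unfold rabiAlpha
  split_ifs with h
  · norm_num
  · have hk : (0 : ℝ) < k := by exact_mod_cast Nat.pos_of_ne_zero h
    have h1 : 0 < ξ * k := by positivity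
    rw [div_le_one (by positivity)]
    have := Real.sin_sq_le_one (Real.pi * Real.sqrt (ξ * k + η))
    nlinarith

lemma sw_nonneg {β ε ξ η : ℝ} (hξ : 0 < ξ) (hη : 0 ≤ η) (k : ℕ) (a : Outcome) :
    0 ≤ stepWeight β ε ξ η k a := by
  have h1 := pM_nonneg β ε
  have h2 := pP_nonneg β ε
  have h3 := al_nonneg hξ hη k
  have h4 := al_nonneg hξ hη (k + 1)
  have h5 := sub_nonneg.2 (al_le hξ hη k)
  have h6 := sub_nonneg.2 (al_le hξ hη (k + 1))
  cases a <;> simp only [stepWeight] <;> positivity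

lemma markov {β ε ξ η : ℝ} (hξ : 0 < ξ) (hη : 0 ≤ η)
    (P : ℕ → Measure (ℕ → Outcome)) (hP : ∀ k, IsProbabilityMeasure (P k))
    (hcyl : ∀ k (w : List Outcome),
      P k (cylinder w) = ENNReal.ofReal (wordWeight β ε ξ η k w)) (k : ℕ) (a : Outcome)
    (A : Set (ℕ → Outcome)) (hA : MeasurableSet A) :
    P k {ω | ω 0 = a ∧ sh ω ∈ A} =
      ENNReal.ofReal (stepWeight β ε ξ η k a) * P (stepSucc k a) A := by
  have hm : MeasurableSet {ω : ℕ → Outcome | ω 0 = a} :=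
    ms0 a
  have e1 : ∀ B, MeasurableSet B → (((P k).restrict {ω | ω 0 = a}).map sh) B =
      P k {ω | ω 0 = a ∧ sh ω ∈ B} := by
    intro B hB
    rw [Measure.map_apply measurable_sh hB, Measure.restrict_apply (measurable_sh hB)]
    congr 1
    ext ω
    simp [and_comm]
  have hc : ∀ w, (((P k).restrict {ω | ω 0 = a}).map sh) (cylinder w) =
      (ENNReal.ofReal (stepWeight β ε ξ η k a) • P (stepSucc k a)) (cylinder w) := by
    intro w
    rw [e1 _ (measurableSet_cyl w)]
    have : {ω | ω 0 = a ∧ sh ω ∈ cylinder w} = cylinder (a :: w) := by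
      ext ω; exact (mem_cyl_cons a w ω).symm
    rw [this, hcyl, wordWeight, ENNReal.ofReal_mul (sw_nonneg hξ hη k a)]
    simp [hcyl]
  have : ((P k).restrict {ω | ω 0 = a}).map sh =
      ENNReal.ofReal (stepWeight β ε ξ η k a) • P (stepSucc k a) := by
    have : IsFiniteMeasure (((P k).restrict {ω | ω 0 = a}).map sh) :=
      Measure.isFiniteMeasure_map _ _
    refine ext_of_generate_finite _ gen_cyl pi_cyl ?_ ?_
    · rintro _ ⟨w, rfl⟩
      exact hc w
    · rw [← cyl_nil]; exact hc []
  rw [← e1 A hA, this]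
  simp

def T (x : ℕ × (ℕ → Outcome)) : ℕ × (ℕ → Outcome) := (stepSucc x.1 (x.2 0), sh x.2)

lemma measurable_T : Measurable T := by
  refine Measurable.prodMk ?_ (measurable_sh.comp measurable_snd)
  have h : Measurable (fun y : ℕ × Outcome => stepSucc y.1 y.2) := by
    have : DiscreteMeasurableSpace Outcome := ⟨fun s => trivial⟩
    exact Measurable.of_discrete
  exact h.comp (measurable_fst.prodMk ((measurable_pi_apply 0).comp measurable_snd))

noncomputable def cc (β ε : ℝ) (k : ℕ) : ℝ≥0∞ := ENNReal.ofReal (Real.exp (-(β * ε))) ^ k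

noncomputable def M (β ε : ℝ) (P : ℕ → Measure (ℕ → Outcome)) : Measure (ℕ × (ℕ → Outcome)) :=
  Measure.sum fun k => cc β ε k • (P k).map (Prod.mk k)

lemma M_apply (β ε : ℝ) (P : ℕ → Measure (ℕ → Outcome)) (B : Set (ℕ × (ℕ → Outcome)))
    (hB : MeasurableSet B) : M β ε P B = ∑' k, cc β ε k * P k (Prod.mk k ⁻¹' B) := by
  rw [M, Measure.sum_apply _ hB]
  congr 1
  ext k
  rw [Measure.smul_apply, Measure.map_apply measurable_prodMk_left hB, smul_eq_mul]

lemma M_finite {β ε : ℝ} (hε : 0 < ε) (hβ : 0 < β) (P : ℕ → Measure (ℕ → Outcome))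
    (hP : ∀ k, IsProbabilityMeasure (P k)) : IsFiniteMeasure (M β ε P) := by
  refine ⟨?_⟩
  rw [M_apply _ _ _ _ MeasurableSet.univ]
  simp only [Set.preimage_univ, measure_univ, mul_one, cc]
  rw [ENNReal.tsum_geometric]
  rw [ENNReal.inv_lt_top, tsub_pos_iff_lt, ENNReal.ofReal_lt_one, Real.exp_lt_one_iff]
  nlinarith [mul_pos hβ hε]

lemma step_sum {β ε ξ η : ℝ} (hξ : 0 < ξ) (hη : 0 ≤ η)
    (P : ℕ → Measure (ℕ → Outcome)) (hP : ∀ k, IsProbabilityMeasure (P k))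
    (hcyl : ∀ k (w : List Outcome),
      P k (cylinder w) = ENNReal.ofReal (wordWeight β ε ξ η k w)) (k : ℕ)
    (B : Set (ℕ × (ℕ → Outcome))) (hB : MeasurableSet B) :
    P k (Prod.mk k ⁻¹' (T ⁻¹' B)) = ∑ a : Outcome,
      ENNReal.ofReal (stepWeight β ε ξ η k a) * P (stepSucc k a)
        (Prod.mk (stepSucc k a) ⁻¹' B) := by
  have hs : Prod.mk k ⁻¹' (T ⁻¹' B) = ⋃ a : Outcome,
      {ω | ω 0 = a ∧ sh ω ∈ Prod.mk (stepSucc k a) ⁻¹' B} := by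
    ext ω
    simp [T]
  rw [hs, measure_iUnion, tsum_fintype]
  · refine Finset.sum_congr rfl fun a _ => ?_
    exact markov hξ hη P hP hcyl k a _ (measurable_prodMk_left hB)
  · intro a b hab
    refine Set.disjoint_left.2 ?_
    rintro ω ⟨h1, -⟩ ⟨h2, -⟩
    exact hab (h1.symm.trans h2)
  · intro a
    have h1 : MeasurableSet {ω : ℕ → Outcome | ω 0 = a} :=
      ms0 a
    exact h1.inter (measurable_sh (measurable_prodMk_left hB))

lemma balance {β ε ξ η : ℝ} (hξ : 0 < ξ) (hη : 0 ≤ η) (f : ℕ → ℝ≥0∞) :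
    ∑' k, cc β ε k * ∑ a : Outcome,
      ENNReal.ofReal (stepWeight β ε ξ η k a) * f (stepSucc k a) = ∑' k, cc β ε k * f k := by
  set pm := ENNReal.ofReal (pMinus β ε) with hpm
  set pp := ENNReal.ofReal (pPlus β ε) with hpp
  set al : ℕ → ℝ≥0∞ := fun k => ENNReal.ofReal (rabiAlpha ξ η k) with hal
  set bl : ℕ → ℝ≥0∞ := fun k => ENNReal.ofReal (1 - rabiAlpha ξ η k) with hbl
  have hab : ∀ k, al k + bl k = 1 := by
    intro k
    simp only [hal, hbl]
    rw [← ENNReal.ofReal_add (al_nonneg hξ hη k) (sub_nonneg.2 (al_le hξ hη k))]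
    simp
  have hp : pm + pp = 1 := by
    rw [hpm, hpp, ← ENNReal.ofReal_add (pM_nonneg _ _) (pP_nonneg _ _)]
    have : pMinus β ε + pPlus β ε = 1 := by
      unfold pMinus pPlus
      have := Real.exp_pos (-(β * ε))
      field_simp
    rw [this]; simp
  have hdb : ∀ k, cc β ε (k + 1) * pm = cc β ε k * pp := by
    intro k
    have : pp = ENNReal.ofReal (Real.exp (-(β * ε))) * pm := by
      rw [hpm, hpp, ← ENNReal.ofReal_mul (Real.exp_pos _).le]
      congr 1
      unfold pMinus pPlus
      ring
    rw [this, cc, cc]; ring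
  have h0 : al 0 = 0 := by simp [hal, rabiAlpha]
  have hterm : ∀ k, cc β ε k * ∑ a : Outcome,
      ENNReal.ofReal (stepWeight β ε ξ η k a) * f (stepSucc k a) =
      cc β ε k * pm * bl k * f k + cc β ε k * pm * al k * f (k - 1)
      + cc β ε k * pp * al (k + 1) * f (k + 1) + cc β ε k * pp * bl (k + 1) * f k := by
    intro k
    have : (Finset.univ : Finset Outcome) =
      {Outcome.mm, Outcome.mp, Outcome.pm, Outcome.pp} := rfl
    rw [this]
    simp [stepWeight, stepSucc, ENNReal.ofReal_mul (pM_nonneg β ε),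
      ENNReal.ofReal_mul (pP_nonneg β ε), hal, hbl, hpm, hpp]
    ring
  have e2 : ∑' k, cc β ε k * pm * al k * f (k - 1) = ∑' k, cc β ε k * pp * al (k + 1) * f k := by
    rw [tsum_eq_zero_add' ENNReal.summable, h0]
    simp [hdb]
  have e3 : ∑' k, cc β ε k * pp * al (k + 1) * f (k + 1) = ∑' k, cc β ε k * pm * al k * f k := by
    rw [tsum_eq_zero_add' (f := fun k => cc β ε k * pm * al k * f k) ENNReal.summable, h0]
    simp [hdb]
  simp_rw [hterm]
  rw [ENNReal.tsum_add, ENNReal.tsum_add, ENNReal.tsum_add, e2, e3,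
    ← ENNReal.tsum_add, ← ENNReal.tsum_add, ← ENNReal.tsum_add]
  congr 1
  ext k
  calc _ = cc β ε k * f k * (pm * (al k + bl k) + pp * (al (k + 1) + bl (k + 1))) := by ring
    _ = _ := by rw [hab, hab, mul_one, mul_one, hp, mul_one]

lemma T_mp {β ε ξ η : ℝ} (hξ : 0 < ξ) (hη : 0 ≤ η)
    (P : ℕ → Measure (ℕ → Outcome)) (hP : ∀ k, IsProbabilityMeasure (P k))
    (hcyl : ∀ k (w : List Outcome),
      P k (cylinder w) = ENNReal.ofReal (wordWeight β ε ξ η k w)) :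
    MeasurePreserving T (M β ε P) (M β ε P) := by
  refine ⟨measurable_T, ?_⟩
  ext B hB
  rw [Measure.map_apply measurable_T hB, M_apply _ _ _ _ (measurable_T hB), M_apply _ _ _ _ hB]
  simp_rw [step_sum hξ hη P hP hcyl _ B hB]
  exact balance hξ hη (fun l => P l (Prod.mk l ⁻¹' B))

lemma iter_snd (k : ℕ) (ω : ℕ → Outcome) (t n : ℕ) : (T^[t] (k, ω)).2 n = ω (n + t) := by
  induction t generalizing n with
  | zero => rfl
  | succ t ih =>
    rw [Function.iterate_succ_apply']
    simp only [T, sh, ih]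
    congr 1; ring

lemma iter_fst (k : ℕ) (ω : ℕ → Outcome)
    (h : ∀ t, ¬ ((T^[t] (k, ω)).1 = 0 ∧ (T^[t] (k, ω)).2 0 = Outcome.mp)) (t : ℕ) :
    ((T^[t] (k, ω)).1 : ℤ) = k + sShift ω t := by
  induction t with
  | zero => simp [sShift]
  | succ t ih =>
    have h1 := h t
    have e := iter_snd k ω t 0
    rw [Function.iterate_succ_apply']
    have es : sShift ω (t + 1) = sShift ω t + outDelta (ω t) := by
      simp [sShift, Finset.sum_range_succ]
    rw [es, ← add_assoc, ← ih]
    rw [zero_add] at e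
    rw [e] at h1
    simp only [T, e]
    cases hω : ω t <;> simp [stepSucc, outDelta]
    simp [hω] at h1
    omega

lemma nfock (k : ℕ) (ω : ℕ → Outcome)
    (h : ∀ t, ¬ ((T^[t] (k, ω)).1 = 0 ∧ (T^[t] (k, ω)).2 0 = Outcome.mp)) (t : ℕ) :
    NFock k ω t = ((T^[t] (k, ω)).1 : ℤ) := by
  have : tauExt k ω = ⊤ := by
    have : {t : ℕ | 1 ≤ t ∧ (k : ℤ) + sShift ω t < 0} = ∅ := by
      ext t
      have := iter_fst k ω h t
      simp only [Set.mem_ofPred_eq, Set.mem_empty_iff_false, iff_false]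
      omega
    simp [tauExt, this]
  rw [iter_fst k ω h, NFock, this, if_pos (ENat.coe_lt_top t)]

end RabiAux

open RabiAux in
/-- under the non-resonant condition and `β > 0`, for every `k`,
`ℙᵏ(A_k) = 1` where `A_k = {ω : N_t(k,ω) = k for infinitely many t}`. -/
theorem statement8 (ε β ξ η : ℝ) (hε : 0 < ε) (hβ : 0 < β) (hξ : 0 < ξ) (hη : 0 ≤ η)
    (hnr : NonResonant ξ η)
    (P : ℕ → MeasureTheory.Measure (ℕ → Outcome))
    (hP : ∀ k, MeasureTheory.IsProbabilityMeasure (P k))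
    (hcyl : ∀ k (w : List Outcome),
      P k (cylinder w) = ENNReal.ofReal (wordWeight β ε ξ η k w)) :
    ∀ k : ℕ, P k {ω | {t : ℕ | NFock k ω t = (k : ℤ)}.Infinite} = 1 := by
  intro k
  have := M_finite hε hβ P hP
  have hT := T_mp hξ hη P hP hcyl
  have hcons := hT.conservative
  have hck : cc β ε k ≠ 0 := by
    have : 0 < ENNReal.ofReal (Real.exp (-(β * ε))) := ENNReal.ofReal_pos.2 (Real.exp_pos _)
    exact pow_ne_zero _ this.ne'
  -- transfer of almost sure statements
  have htr : ∀ p : ℕ × (ℕ → Outcome) → Prop, (∀ᵐ x ∂(M β ε P), p x) →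
      ∀ᵐ ω ∂(P k), p (k, ω) := by
    intro p hp
    have h1 := (Measure.ae_sum_iff' (μ := fun k => cc β ε k • (P k).map (Prod.mk k))
      (measurableSet_toMeasurable (M β ε P) {x | ¬ p x}).compl).1 (by
        have : M β ε P (toMeasurable (M β ε P) {x | ¬ p x}) = 0 := by
          rw [measure_toMeasurable]; exact hp
        exact measure_eq_zero_iff_ae_notMem.1 this) k
    have h2 := (Measure.ae_ennreal_smul_measure_iff hck).1 h1
    have h3 := ae_of_ae_map measurable_prodMk_left.aemeasurable h2
    filter_upwards [h3] with ω hω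
    by_contra hcon
    exact hω (subset_toMeasurable (M β ε P) {x | ¬ p x} hcon)
  have hbad0 : ∀ᵐ x ∂(M β ε P), ¬ (x.1 = 0 ∧ x.2 0 = Outcome.mp) := by
    have hmeas : MeasurableSet {x : ℕ × (ℕ → Outcome) | x.1 = 0 ∧ x.2 0 = Outcome.mp} := by
      have a1 : MeasurableSet {x : ℕ × (ℕ → Outcome) | x.1 = 0} :=
        measurable_fst (measurableSet_singleton 0)
      have a2 : MeasurableSet {x : ℕ × (ℕ → Outcome) | x.2 0 = Outcome.mp} :=
        measurable_snd (ms0 Outcome.mp)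
      exact a1.inter a2
    have : M β ε P {x | x.1 = 0 ∧ x.2 0 = Outcome.mp} = 0 := by
      rw [M_apply _ _ _ _ hmeas, ENNReal.tsum_eq_zero]
      intro j
      rcases Nat.eq_zero_or_pos j with rfl | hj
      · have := markov hξ hη P hP hcyl 0 Outcome.mp Set.univ MeasurableSet.univ
        simp [stepWeight, rabiAlpha] at this
        simp [this]
      · simp [hj.ne']
    exact measure_eq_zero_iff_ae_notMem.1 this
  have hbad : ∀ᵐ x ∂(M β ε P), ∀ t, ¬ ((T^[t] x).1 = 0 ∧ (T^[t] x).2 0 = Outcome.mp) := by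
    rw [ae_all_iff]
    intro t
    exact (hT.iterate t).quasiMeasurePreserving.ae hbad0
  have hrec := hcons.ae_mem_imp_frequently_image_mem (s := Prod.fst ⁻¹' {k})
    (measurable_fst (measurableSet_singleton k)).nullMeasurableSet
  have hall : ∀ᵐ ω ∂(P k), {t : ℕ | NFock k ω t = (k : ℤ)}.Infinite := by
    filter_upwards [htr _ hbad, htr _ hrec] with ω h1 h2
    have h3 := Nat.frequently_atTop_iff_infinite.1 (h2 rfl)
    refine h3.mono fun t ht => ?_
    simp only [Set.mem_ofPred_eq] at ht ⊢
    rw [nfock k ω h1, ht]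
  have := hP k
  have : {ω | {t : ℕ | NFock k ω t = (k : ℤ)}.Infinite} =ᵐ[P k] Set.univ :=
    eventuallyEq_univ.2 hall
  rw [measure_congr this, measure_univ]
end

section
/- Assume the non-resonant condition holds and β > 0. For every k ∈ ℕ, the first return time T_k(ω) = inf{t ≥ 1 : N_t(k,ω) = k} is ℙᵏ-almost surely finite and has finite expectation under ℙᵏ (positive recurrence of the birth–death chain; part of Proposition 3.1). -/
open MeasureTheory Filter Real
open scoped ENNReal

namespace St9

def Xp (k : ℕ) (ω : ℕ → Outcome) : ℕ → ℕ
  | 0 => k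
  | i + 1 => stepSucc (Xp k ω i) (ω i)

def endp : ℕ → List Outcome → ℕ
  | k, [] => k
  | k, a :: w => endp (stepSucc k a) w

instance : Fintype Outcome := ⟨{.mm, .mp, .pm, .pp}, by intro x; cases x <;> decide⟩

instance : DiscreteMeasurableSpace Outcome := ⟨fun _ => trivial⟩

lemma sum_out {M : Type*} [AddCommMonoid M] (F : Outcome → M) :
    ∑ a, F a = F .mm + (F .mp + (F .pm + F .pp)) := by
  have : (Finset.univ : Finset Outcome) = {.mm, .mp, .pm, .pp} := rfl
  rw [this]
  rw [Finset.sum_insert (by decide), Finset.sum_insert (by decide), Finset.sum_insert (by decide),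
    Finset.sum_singleton]

lemma endp_append (k : ℕ) (w : List Outcome) (a : Outcome) :
    endp k (w ++ [a]) = stepSucc (endp k w) a := by
  induction w generalizing k with
  | nil => rfl
  | cons b w ih => simp [endp, ih]

lemma ww_append (β ε ξ η : ℝ) (k : ℕ) (w : List Outcome) (a : Outcome) :
    wordWeight β ε ξ η k (w ++ [a]) =
      wordWeight β ε ξ η k w * stepWeight β ε ξ η (endp k w) a := by
  induction w generalizing k with
  | nil => simp [wordWeight, endp]
  | cons b w ih => simp [wordWeight, endp, ih, mul_assoc]

lemma mem_cyl_append (w : List Outcome) (a : Outcome) (ω : ℕ → Outcome) :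
    ω ∈ cylinder (w ++ [a]) ↔ ω ∈ cylinder w ∧ ω w.length = a := by
  simp only [_root_.cylinder, Set.mem_ofPred_eq]
  constructor
  · intro h
    refine ⟨fun i => ?_, ?_⟩
    · have := h ⟨i, by have := i.2; rw [List.length_append]; omega⟩
      simpa [List.getElem_append_left] using this
    · have := h ⟨w.length, by simp⟩
      simpa using this
  · rintro ⟨h1, h2⟩ ⟨i, hi⟩
    simp at hi
    rcases Nat.lt_or_eq_of_le hi with h | h
    · have := h1 ⟨i, h⟩
      simpa [List.getElem_append_left h] using this
    · subst h
      simpa using h2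

lemma Xp_cyl (k : ℕ) (w : List Outcome) (ω : ℕ → Outcome) (h : ω ∈ cylinder w) :
    Xp k ω w.length = endp k w := by
  induction w using List.reverseRecOn with
  | nil => rfl
  | append_singleton w a ih =>
    rw [mem_cyl_append] at h
    rw [endp_append, ← ih h.1, List.length_append, ← h.2]
    rfl

lemma exists_cyl (ω : ℕ → Outcome) (n : ℕ) : ∃ w : List Outcome, w.length = n ∧ ω ∈ cylinder w := by
  refine ⟨List.ofFn (fun i : Fin n => ω i), by simp, ?_⟩
  intro i
  simp

lemma Xp_meas (k : ℕ) (i : ℕ) : Measurable (fun ω => Xp k ω i) := by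
  induction i with
  | zero => exact measurable_const
  | succ i ih =>
    have h : Measurable (fun p : ℕ × Outcome => stepSucc p.1 p.2) := Measurable.of_discrete
    exact h.comp (ih.prodMk (measurable_pi_apply i))

noncomputable def S (β ε ξ η : ℝ) (k : ℕ) : ℕ → ℕ → ℝ
  | 0, _ => 1
  | t + 1, j => ∑ a, stepWeight β ε ξ η j a *
      (if stepSucc j a = k then 0 else S β ε ξ η k t (stepSucc j a))

lemma pm_pos (β ε : ℝ) : 0 < pMinus β ε := by unfold pMinus; positivity
lemma pp_pos (β ε : ℝ) : 0 < pPlus β ε := by unfold pPlus; positivity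
lemma p_add (β ε : ℝ) : pMinus β ε + pPlus β ε = 1 := by
  unfold pMinus pPlus
  have : 0 < Real.exp (-(β * ε)) := Real.exp_pos _
  field_simp

lemma alpha_nonneg {ξ η : ℝ} (hξ : 0 < ξ) (hη : 0 ≤ η) (k : ℕ) : 0 ≤ rabiAlpha ξ η k := by
  unfold rabiAlpha; split_ifs
  · exact le_rfl
  · positivity

lemma alpha_le {ξ η : ℝ} (hξ : 0 < ξ) (hη : 0 ≤ η) (k : ℕ) : rabiAlpha ξ η k ≤ 1 := by
  unfold rabiAlpha; split_ifs with h
  · exact zero_le_one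
  · have hk : 0 < (k : ℝ) := by exact_mod_cast Nat.pos_of_ne_zero h
    have : 0 < ξ * k := by positivity
    rw [div_le_one (by positivity)]
    have := Real.sin_sq_le_one (Real.pi * Real.sqrt (ξ * k + η))
    nlinarith

lemma alpha_pos {ξ η : ℝ} (hξ : 0 < ξ) (hη : 0 ≤ η) (hnr : NonResonant ξ η) (k : ℕ) (h : k ≠ 0) :
    0 < rabiAlpha ξ η k := by
  unfold rabiAlpha; rw [if_neg h]
  have hk : 0 < (k : ℝ) := by exact_mod_cast Nat.pos_of_ne_zero h
  have h1 : 0 < ξ * k := by positivity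
  have : Real.sin (Real.pi * Real.sqrt (ξ * k + η)) ≠ 0 := by
    intro h0
    rw [Real.sin_eq_zero_iff] at h0
    obtain ⟨n, hn⟩ := h0
    have hn' : (n : ℝ) = Real.sqrt (ξ * k + η) := by
      have := Real.pi_pos
      have h3 : Real.pi * (n : ℝ) = Real.pi * Real.sqrt (ξ * k + η) := by linarith
      exact mul_left_cancel₀ this.ne' h3
    refine hnr k ⟨Nat.pos_of_ne_zero h, n.natAbs, ?_⟩
    rw [Nat.cast_natAbs, Int.cast_abs, sq_abs, hn', Real.sq_sqrt (by positivity)]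
  positivity

lemma q_nonneg {β ε ξ η : ℝ} (hξ : 0 < ξ) (hη : 0 ≤ η) (k : ℕ) (a : Outcome) :
    0 ≤ stepWeight β ε ξ η k a := by
  have h1 := pm_pos β ε
  have h2 := pp_pos β ε
  have h3 := alpha_nonneg hξ hη
  have h4 := fun k => sub_nonneg.2 (alpha_le hξ hη k)
  cases a
  · exact mul_nonneg h1.le (h4 _)
  · exact mul_nonneg h1.le (h3 _)
  · exact mul_nonneg h2.le (h3 _)
  · exact mul_nonneg h2.le (h4 _)

lemma ww_nonneg {β ε ξ η : ℝ} (hξ : 0 < ξ) (hη : 0 ≤ η) (k : ℕ) (w : List Outcome) :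
    0 ≤ wordWeight β ε ξ η k w := by
  induction w generalizing k with
  | nil => simp [wordWeight]
  | cons a w ih => exact mul_nonneg (q_nonneg hξ hη _ _) (ih _)

lemma S_nonneg {β ε ξ η : ℝ} (hξ : 0 < ξ) (hη : 0 ≤ η) (k t j : ℕ) :
    0 ≤ S β ε ξ η k t j := by
  induction t generalizing j with
  | zero => simp [S]
  | succ t ih =>
    refine Finset.sum_nonneg fun a _ => mul_nonneg (q_nonneg hξ hη _ _) ?_
    split_ifs
    · exact le_rfl
    · exact ih _

lemma surv_le {β ε ξ η : ℝ} (hξ : 0 < ξ) (hη : 0 ≤ η) (k : ℕ) (P : Measure (ℕ → Outcome))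
    (hcyl : ∀ w : List Outcome, P (cylinder w) = ENNReal.ofReal (wordWeight β ε ξ η k w))
    (t : ℕ) (u : List Outcome) :
    P (cylinder u ∩ {ω | ∀ i, u.length < i → i ≤ u.length + t → Xp k ω i ≠ k}) ≤
      ENNReal.ofReal (wordWeight β ε ξ η k u * S β ε ξ η k t (endp k u)) := by
  induction t generalizing u with
  | zero =>
    refine (measure_mono Set.inter_subset_left).trans ?_
    rw [hcyl]; simp [S]
  | succ t ih =>
    have hsub : (cylinder u ∩ {ω | ∀ i, u.length < i → i ≤ u.length + (t + 1) → Xp k ω i ≠ k}) ⊆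
        ⋃ a ∈ (Finset.univ : Finset Outcome), (cylinder (u ++ [a]) ∩
          {ω | ∀ i, u.length < i → i ≤ u.length + (t + 1) → Xp k ω i ≠ k}) := by
      rintro ω ⟨h1, h2⟩
      simp only [Set.mem_iUnion]
      exact ⟨ω u.length, Finset.mem_univ _, (mem_cyl_append _ _ _).2 ⟨h1, rfl⟩, h2⟩
    refine (measure_mono hsub).trans ((measure_biUnion_finset_le _ _).trans ?_)
    rw [S, Finset.mul_sum, ENNReal.ofReal_sum_of_nonneg]
    · refine Finset.sum_le_sum fun a _ => ?_
      split_ifs with h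
      · have : (cylinder (u ++ [a]) ∩
          {ω | ∀ i, u.length < i → i ≤ u.length + (t + 1) → Xp k ω i ≠ k}) = ∅ := by
          rw [Set.eq_empty_iff_forall_notMem]
          rintro ω ⟨h1, h2⟩
          have := Xp_cyl k _ _ h1
          rw [endp_append, h] at this
          refine h2 (u ++ [a]).length (by simp) (by simp) this
        rw [this]; simp
      · rw [← mul_assoc, ← ww_append, ← endp_append]
        refine le_trans (measure_mono ?_) (ih (u ++ [a]))
        refine Set.inter_subset_inter_right _ ?_
        intro ω h2 i hi1 hi2
        simp at hi1 hi2
        exact h2 i (by omega) (by omega)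
    · intro a _
      refine mul_nonneg (ww_nonneg hξ hη _ _) (mul_nonneg (q_nonneg hξ hη _ _) ?_)
      split_ifs
      · exact le_rfl
      · exact S_nonneg hξ hη _ _ _

noncomputable def ff (b d : ℕ → ℝ) : ℕ → ℝ
  | 0 => 1 / b 0
  | j + 1 => (1 + d (j + 1) * ff b d j) / b (j + 1)

lemma exists_V {β ε ξ η : ℝ} (hε : 0 < ε) (hβ : 0 < β) (hξ : 0 < ξ) (hη : 0 ≤ η)
    (hnr : NonResonant ξ η) (k : ℕ) : ∃ V : ℕ → ℝ, (∀ j, 0 ≤ V j) ∧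
      ∀ j, j ≠ k → 1 + ∑ a, stepWeight β ε ξ η j a * V (stepSucc j a) ≤ V j := by
  obtain ⟨b, hb⟩ : ∃ b : ℕ → ℝ, b = fun j => pPlus β ε * rabiAlpha ξ η (j + 1) := ⟨_, rfl⟩
  obtain ⟨d, hd⟩ : ∃ d : ℕ → ℝ, d = fun j => pMinus β ε * rabiAlpha ξ η j := ⟨_, rfl⟩
  have hpm := pm_pos β ε
  have hpp := pp_pos β ε
  have hlt : pPlus β ε < pMinus β ε := by
    unfold pMinus pPlus
    have h1 : Real.exp (-(β * ε)) < 1 := by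
      rw [Real.exp_lt_one_iff]; have := mul_pos hβ hε; linarith
    have := Real.exp_pos (-(β * ε))
    gcongr
  have hb0 : ∀ j, 0 < b j := fun j => by
    rw [hb]; exact mul_pos hpp (alpha_pos hξ hη hnr _ (by omega))
  have hd0 : ∀ j, 0 ≤ d j := fun j => by
    rw [hd]; exact mul_nonneg hpm.le (alpha_nonneg hξ hη _)
  have hd00 : d 0 = 0 := by simp [hd, rabiAlpha]
  have hf0 : ∀ j, 0 ≤ ff b d j := by
    intro j
    induction j with
    | zero => exact div_nonneg zero_le_one (hb0 _).le
    | succ j ih =>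
      exact div_nonneg (add_nonneg zero_le_one (mul_nonneg (hd0 _) ih)) (hb0 _).le
  obtain ⟨e, he⟩ : ∃ e : ℕ → ℝ, e = fun j =>
    1 / ((pMinus β ε - pPlus β ε) * rabiAlpha ξ η j) := ⟨_, rfl⟩
  have he0 : ∀ j, 0 ≤ e j := fun j => by
    rw [he]
    exact div_nonneg zero_le_one (mul_nonneg (by linarith) (alpha_nonneg hξ hη _))
  have hee : ∀ j, j ≠ 0 → d j * e j = 1 + b j * e (j + 1) := by
    intro j hj
    have h1 := alpha_pos hξ hη hnr j hj
    have h2 := alpha_pos hξ hη hnr (j + 1) (by omega)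
    have h3 : pMinus β ε - pPlus β ε ≠ 0 := by linarith
    simp only [hb, hd, he]
    field_simp
    ring
  have hff0 : b 0 * ff b d 0 = 1 := by
    have := (hb0 0).ne'
    simp only [ff]; field_simp
  have hffs : ∀ j, b (j + 1) * ff b d (j + 1) = 1 + d (j + 1) * ff b d j := by
    intro j
    have := (hb0 (j + 1)).ne'
    simp only [ff]; field_simp
  let V : ℕ → ℝ := fun j => ∑ i ∈ Finset.Ico k j, e (i + 1) + ∑ i ∈ Finset.Ico j k, ff b d i
  have hVup : ∀ j, k ≤ j → V (j + 1) = V j + e (j + 1) := by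
    intro j hj
    simp only [V]
    rw [Finset.sum_Ico_succ_top hj, Finset.Ico_eq_empty_of_le hj,
      Finset.Ico_eq_empty_of_le (by omega : k ≤ j + 1)]
    simp
  have hVdn : ∀ j, j < k → V j = V (j + 1) + ff b d j := by
    intro j hj
    simp only [V]
    rw [Finset.sum_eq_sum_Ico_succ_bot hj, Finset.Ico_eq_empty_of_le hj.le,
      Finset.Ico_eq_empty_of_le (by omega : j + 1 ≤ k)]
    simp; ring
  refine ⟨V, fun j => add_nonneg (Finset.sum_nonneg fun i _ => he0 _)
    (Finset.sum_nonneg fun i _ => hf0 _), ?_⟩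
  intro j hj
  have hsum : ∑ a, stepWeight β ε ξ η j a * V (stepSucc j a) =
      V j + d j * (V (j - 1) - V j) + b j * (V (j + 1) - V j) := by
    rw [sum_out]
    simp only [stepWeight, stepSucc, hb, hd]
    linear_combination (V j) * p_add β ε
  rw [hsum]
  rcases lt_or_gt_of_ne hj with h | h
  · have h1 := hVdn j h
    rcases j with _ | j
    · rw [hd00, show V (0 + 1) - V 0 = - ff b d 0 by linarith]; linarith
    · have h2 := hVdn j (by omega)
      have h3 := hffs j
      simp only [Nat.add_sub_cancel]
      rw [h2]
      have : V (j + 1 + 1) - V (j + 1) = - ff b d (j + 1) := by linarith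
      rw [this]; linarith
  · obtain ⟨j, rfl⟩ : ∃ i, j = i + 1 := ⟨j - 1, by omega⟩
    have h1 := hVup (j + 1) (by omega)
    have h2 := hVup j (by omega)
    have h3 := hee (j + 1) (by omega)
    simp only [Nat.add_sub_cancel]
    have e1 : V j - V (j + 1) = - e (j + 1) := by linarith
    have e2 : V (j + 1 + 1) - V (j + 1) = e (j + 1 + 1) := by linarith
    rw [e1, e2]; linarith

lemma H_succ (β ε ξ η : ℝ) (k t j : ℕ) :
    ∑ s ∈ Finset.range (t + 1), S β ε ξ η k s j = 1 + ∑ a, stepWeight β ε ξ η j a *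
      (if stepSucc j a = k then 0 else ∑ s ∈ Finset.range t, S β ε ξ η k s (stepSucc j a)) := by
  rw [Finset.sum_range_succ', add_comm]
  simp only [S]
  rw [Finset.sum_comm]
  congr 1
  refine Finset.sum_congr rfl fun a _ => ?_
  rw [← Finset.mul_sum]
  split_ifs <;> simp

lemma exists_C {β ε ξ η : ℝ} (hε : 0 < ε) (hβ : 0 < β) (hξ : 0 < ξ) (hη : 0 ≤ η)
    (hnr : NonResonant ξ η) (k : ℕ) : ∃ C : ℝ, ∀ t,
      ∑ s ∈ Finset.range t, S β ε ξ η k s k ≤ C := by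
  obtain ⟨V, hV0, hV⟩ := exists_V (β := β) (ε := ε) hε hβ hξ hη hnr k
  have key : ∀ t j, ∑ s ∈ Finset.range (t + 1), S β ε ξ η k s j ≤
      1 + ∑ a, stepWeight β ε ξ η j a * V (stepSucc j a) := by
    intro t
    induction t with
    | zero =>
      intro j
      simp only [zero_add, Finset.sum_range_one, S]
      have := Finset.sum_nonneg fun a (_ : a ∈ (Finset.univ : Finset Outcome)) =>
        mul_nonneg (q_nonneg (β := β) (ε := ε) hξ hη j a) (hV0 (stepSucc j a))
      linarith
    | succ t ih =>
      intro j
      rw [H_succ]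
      gcongr with a _
      · exact q_nonneg hξ hη j a
      · split_ifs with h
        · exact hV0 _
        · exact (ih _).trans (hV _ h)
  refine ⟨1 + ∑ a, stepWeight β ε ξ η k a * V (stepSucc k a), fun t => ?_⟩
  refine le_trans ?_ (key t k)
  rw [Finset.sum_range_succ]
  linarith [S_nonneg (β := β) (ε := ε) hξ hη k t k]

lemma Xp_eq (k : ℕ) (ω : ℕ → Outcome) (hD : ∀ i, Xp k ω i = 0 → ω i ≠ .mp) (i : ℕ) :
    (Xp k ω i : ℤ) = k + sShift ω i := by
  induction i with
  | zero => simp [Xp, sShift]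
  | succ i ih =>
    have h2 : sShift ω (i + 1) = sShift ω i + outDelta (ω i) := Finset.sum_range_succ _ _
    have h3 := hD i
    rw [h2, ← add_assoc, ← ih, Xp]
    rcases h : ω i
    · simp [stepSucc, outDelta]
    · have : Xp k ω i ≠ 0 := fun h0 => h3 h0 h
      simp only [stepSucc, outDelta]; omega
    · simp [stepSucc, outDelta]
    · simp [stepSucc, outDelta]

lemma fr_le (k : ℕ) (ω : ℕ → Outcome) (hD : ∀ i, Xp k ω i = 0 → ω i ≠ .mp) (t : ℕ)
    (ht : 1 ≤ t) (h : Xp k ω t = k) : firstReturn k ω ≤ t := by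
  refine sInf_le ⟨t, ⟨ht, ?_⟩, rfl⟩
  have htau : tauExt k ω = ⊤ := by
    unfold tauExt
    have : {t : ℕ | 1 ≤ t ∧ (k : ℤ) + sShift ω t < 0} = ∅ := by
      rw [Set.eq_empty_iff_forall_notMem]
      rintro s ⟨_, hs⟩
      rw [← Xp_eq k ω hD] at hs
      omega
    rw [this]; simp
  unfold NFock
  rw [htau, if_pos (by simp), ← Xp_eq k ω hD, h]

def Bs (k t : ℕ) : Set (ℕ → Outcome) := {ω | ∀ i, 0 < i → i ≤ t → Xp k ω i ≠ k}

lemma Bs_meas (k t : ℕ) : MeasurableSet (Bs k t) := by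
  have : Bs k t = ⋂ i, ⋂ (_ : 0 < i), ⋂ (_ : i ≤ t), (fun ω => Xp k ω i) ⁻¹' {k}ᶜ := by
    ext ω; simp [Bs]
  rw [this]
  exact MeasurableSet.iInter fun i => MeasurableSet.iInter fun _ => MeasurableSet.iInter fun _ =>
    Xp_meas k i (MeasurableSet.of_discrete)

noncomputable def g (k : ℕ) (ω : ℕ → Outcome) : ℝ≥0∞ := ∑' t, (Bs k t).indicator 1 ω

lemma fr_le_g (k : ℕ) (ω : ℕ → Outcome) (hD : ∀ i, Xp k ω i = 0 → ω i ≠ .mp) :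
    ((firstReturn k ω : ℕ∞) : ℝ≥0∞) ≤ g k ω := by
  classical
  by_cases h : ∃ t, 1 ≤ t ∧ Xp k ω t = k
  · have h1 := fr_le k ω hD (Nat.find h) (Nat.find_spec h).1 (Nat.find_spec h).2
    have h2 : ((firstReturn k ω : ℕ∞) : ℝ≥0∞) ≤ (Nat.find h : ℝ≥0∞) := by
      have := ENat.toENNReal_le.2 h1
      simpa using this
    refine h2.trans (le_trans ?_ (ENNReal.sum_le_tsum (Finset.range (Nat.find h))))
    rw [Finset.sum_congr rfl (g := fun _ => (1 : ℝ≥0∞))]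
    · simp
    · intro t ht
      rw [Set.indicator_of_mem]
      · rfl
      · intro i hi1 hi2 hi3
        exact Nat.find_min h (lt_of_le_of_lt hi2 (Finset.mem_range.1 ht)) ⟨hi1, hi3⟩
  · push Not at h
    have : g k ω = ⊤ := by
      unfold g
      rw [tsum_congr (g := fun _ => (1 : ℝ≥0∞))]
      · exact ENNReal.tsum_const_eq_top_of_ne_zero one_ne_zero
      · intro t
        rw [Set.indicator_of_mem]
        · rfl
        · intro i hi1 _
          exact h i hi1
    rw [this]; exact le_top

lemma ae_D {β ε ξ η : ℝ} (k : ℕ) (P : Measure (ℕ → Outcome))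
    (hcyl : ∀ w : List Outcome, P (cylinder w) = ENNReal.ofReal (wordWeight β ε ξ η k w)) :
    ∀ᵐ ω ∂P, ∀ i, Xp k ω i = 0 → ω i ≠ .mp := by
  have h : ∀ᵐ ω ∂P, ∀ u : List Outcome, endp k u = 0 → ω ∉ _root_.cylinder (u ++ [Outcome.mp]) := by
    rw [ae_all_iff]
    intro u
    by_cases hu : endp k u = 0
    · have : P (_root_.cylinder (u ++ [Outcome.mp])) = 0 := by
        rw [hcyl, ww_append, hu]; simp [stepWeight, rabiAlpha]
      filter_upwards [measure_eq_zero_iff_ae_notMem.1 this] with ω hω _ using hω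
    · exact Eventually.of_forall fun ω h => absurd h hu
  filter_upwards [h] with ω hω i hi hmp
  obtain ⟨u, hu1, hu2⟩ := exists_cyl ω i
  subst hu1
  exact hω u (by rw [← Xp_cyl k u ω hu2, hi]) ((mem_cyl_append _ _ _).2 ⟨hu2, hmp⟩)

end St9

/-- under the non-resonant condition and `β > 0`, for every `k` the first
return time `T_k = inf{t ≥ 1 : N_t(k,·) = k}` is `ℙᵏ`-a.s. finite and has finite
expectation (positive recurrence). -/
theorem statement9 (ε β ξ η : ℝ) (hε : 0 < ε) (hβ : 0 < β) (hξ : 0 < ξ) (hη : 0 ≤ η)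
    (hnr : NonResonant ξ η)
    (P : ℕ → MeasureTheory.Measure (ℕ → Outcome))
    (hP : ∀ k, MeasureTheory.IsProbabilityMeasure (P k))
    (hcyl : ∀ k (w : List Outcome),
      P k (cylinder w) = ENNReal.ofReal (wordWeight β ε ξ η k w)) :
    ∀ k : ℕ,
      P k {ω | firstReturn k ω = ⊤} = 0 ∧
      (∫⁻ ω, ((firstReturn k ω : ℕ∞) : ℝ≥0∞) ∂ (P k)) < ⊤ := by
  intro k
  have hc := hcyl k
  have hB : ∀ t, P k (St9.Bs k t) ≤ ENNReal.ofReal (St9.S β ε ξ η k t k) := by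
    intro t
    have := St9.surv_le hξ hη k (P k) hc t []
    simpa [wordWeight, St9.endp, _root_.cylinder, St9.Bs] using this
  obtain ⟨C, hC⟩ := St9.exists_C (β := β) (ε := ε) hε hβ hξ hη hnr k
  have hm : ∀ t, Measurable ((St9.Bs k t).indicator (1 : (ℕ → Outcome) → ℝ≥0∞)) :=
    fun t => measurable_one.indicator (St9.Bs_meas k t)
  have hgm : Measurable (St9.g k) := Measurable.tsum hm
  have hg : ∫⁻ ω, St9.g k ω ∂(P k) < ⊤ := by
    unfold St9.g
    rw [lintegral_tsum fun t => (hm t).aemeasurable]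
    refine lt_of_le_of_lt ?_ (ENNReal.ofReal_lt_top (r := C))
    refine le_trans (ENNReal.tsum_le_tsum (g := fun t => ENNReal.ofReal (St9.S β ε ξ η k t k))
      fun t => ?_) ?_
    · rw [lintegral_indicator_one (St9.Bs_meas k t)]
      exact hB t
    · refine ENNReal.tsum_le_of_sum_range_le fun n => ?_
      rw [← ENNReal.ofReal_sum_of_nonneg fun i _ => St9.S_nonneg hξ hη k i k]
      exact ENNReal.ofReal_le_ofReal (hC n)
  have hae := St9.ae_D k (P k) hc
  constructor
  · rw [measure_eq_zero_iff_ae_notMem]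
    filter_upwards [hae, ae_lt_top hgm hg.ne] with ω h1 h2 h3
    have := St9.fr_le_g k ω h1
    rw [h3] at this
    simp at this
    exact h2.ne this
  · refine lt_of_le_of_lt (lintegral_mono_ae ?_) hg
    filter_upwards [hae] with ω h1 using St9.fr_le_g k ω h1
end

section
/- Assume the non-resonant condition holds and β ≤ 0. Then the birth–death kernel p has no invariant probability distribution: there is no ν : ℕ → ℝ with ν(k) ≥ 0 for all k, ∑_{k∈ℕ} ν(k) = 1 and ∑_{k∈ℕ} ν(k)·p(k,ℓ) = ν(ℓ) for all ℓ ∈ ℕ. -/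
open MeasureTheory Filter Real
open scoped ENNReal

theorem alpha_ne (ξ η : ℝ) (hξ : 0 < ξ) (hη : 0 ≤ η) (hnr : NonResonant ξ η) (k : ℕ) :
    rabiAlpha ξ η (k + 1) ≠ 0 := by
  have hk : 0 < ξ * ((k + 1 : ℕ) : ℝ) := by positivity
  unfold rabiAlpha
  rw [if_neg (Nat.succ_ne_zero k)]
  refine div_ne_zero (mul_ne_zero (pow_ne_zero 2 ?_) hk.ne') (by positivity)
  intro h
  rw [Real.sin_eq_zero_iff] at h
  obtain ⟨n, hn⟩ := h
  have h1 : Real.sqrt (ξ * ((k + 1 : ℕ) : ℝ) + η) = n := by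
    have := Real.pi_pos
    apply mul_left_cancel₀ this.ne'
    linarith
  refine hnr (k + 1) ⟨by omega, n.natAbs, ?_⟩
  have h2 := Real.sq_sqrt (show 0 ≤ ξ * ((k + 1 : ℕ) : ℝ) + η by positivity)
  rw [← h2, h1, Nat.cast_natAbs, Int.cast_abs, sq_abs]

theorem kernel_tsum_zero (β ε ξ η : ℝ) (ν : ℕ → ℝ) :
    (∑' k : ℕ, ν k * bdKernel β ε ξ η k 0) =
      ν 0 * (1 - pPlus β ε * rabiAlpha ξ η 1) + ν 1 * (pMinus β ε * rabiAlpha ξ η 1) := by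
  rw [tsum_eq_sum (s := {0, 1})]
  · simp [bdKernel, rabiAlpha]
  · intro k hk
    simp at hk
    have : bdKernel β ε ξ η k 0 = 0 := by
      unfold bdKernel
      rw [if_neg (by omega), if_neg (by omega), if_neg (by omega)]
    simp [this]

theorem kernel_tsum_succ (β ε ξ η : ℝ) (ν : ℕ → ℝ) (l : ℕ) :
    (∑' k : ℕ, ν k * bdKernel β ε ξ η k (l + 1)) =
      ν l * (pPlus β ε * rabiAlpha ξ η (l + 1)) +
      (ν (l + 1) * (1 - pMinus β ε * rabiAlpha ξ η (l + 1) - pPlus β ε * rabiAlpha ξ η (l + 2))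
      + ν (l + 2) * (pMinus β ε * rabiAlpha ξ η (l + 2))) := by
  rw [tsum_eq_sum (s := {l, l + 1, l + 2})]
  · rw [Finset.sum_insert (by simp), Finset.sum_insert (by simp), Finset.sum_singleton]
    simp [bdKernel]
  · intro k hk
    simp at hk
    have : bdKernel β ε ξ η k (l + 1) = 0 := by
      unfold bdKernel
      rw [if_neg (by omega), if_neg (by omega), if_neg (by omega)]
    simp [this]

/-- under the non-resonant condition and `β ≤ 0`, the birth–death kernel
has no invariant probability distribution. -/
theorem statement12 (ε β ξ η : ℝ) (hε : 0 < ε) (hβ : β ≤ 0) (hξ : 0 < ξ) (hη : 0 ≤ η)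
    (hnr : NonResonant ξ η) :
    ¬ ∃ ν : ℕ → ℝ, (∀ k, 0 ≤ ν k) ∧ (∑' k : ℕ, ν k) = 1 ∧
      ∀ l : ℕ, (∑' k : ℕ, ν k * bdKernel β ε ξ η k l) = ν l := by
  rintro ⟨ν, hpos, hsum, hinv⟩
  have hbal : ∀ l, ν (l + 1) * (pMinus β ε * rabiAlpha ξ η (l + 1)) =
      ν l * (pPlus β ε * rabiAlpha ξ η (l + 1)) := by
    intro l
    induction l with
    | zero =>
      have h := hinv 0
      rw [kernel_tsum_zero] at h
      simp only [zero_add]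
      linarith
    | succ l ih =>
      have h := hinv (l + 1)
      rw [kernel_tsum_succ] at h
      simp only [add_assoc, Nat.reduceAdd] at h ih ⊢
      linarith
  have hstep : ∀ l, ν l ≤ ν (l + 1) := by
    intro l
    have h := hbal l
    have ha := alpha_ne ξ η hξ hη hnr l
    have he : 1 ≤ Real.exp (-(β * ε)) := Real.one_le_exp (by nlinarith)
    have h2 : ν (l + 1) * pMinus β ε = ν l * pPlus β ε := by
      apply mul_right_cancel₀ ha
      linarith
    have h3 : ν (l + 1) = ν l * Real.exp (-(β * ε)) := by
      unfold pMinus pPlus at h2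
      field_simp at h2
      linarith
    rw [h3]
    exact le_mul_of_one_le_right (hpos l) he
  have hmono : Monotone ν := monotone_nat_of_le_succ hstep
  have hs : Summable ν := by
    by_contra hns
    rw [tsum_eq_zero_of_not_summable hns] at hsum
    exact zero_ne_one hsum
  have hz : ∀ k, ν k = 0 := fun k =>
    le_antisymm (hmono.ge_of_tendsto hs.tendsto_atTop_zero k) (hpos k)
  simp [hz] at hsum
end

section
/- Let ξ > 0 be real and let n_k, n_l be integers with 1 ≤ n_k < n_l. Suppose ξ·n_l = q² for some positive integer q. Then sin²(π√(ξ(n_k+1))) ≠ sin²(π√(ξ(n_l+1))). (In the perfectly tuned case η = 0, this shows that two distinct Rabi sectors can never have identical transition probabilities, so purification always holds for a perfectly tuned cavity.) -/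
open MeasureTheory Filter Real
open scoped ENNReal

/-- in the perfectly tuned case, if `1 ≤ n_k < n_l` and `ξ n_l = q²` for a
positive integer `q`, then `sin²(π√(ξ(n_k+1))) ≠ sin²(π√(ξ(n_l+1)))`. -/
theorem statement14 (ξ : ℝ) (hξ : 0 < ξ) (nk nl : ℕ) (hnk : 1 ≤ nk) (hlt : nk < nl)
    (hq : ∃ q : ℕ, 0 < q ∧ ξ * (nl : ℝ) = (q : ℝ) ^ 2) :
    Real.sin (Real.pi * Real.sqrt (ξ * ((nk : ℝ) + 1))) ^ 2 ≠
      Real.sin (Real.pi * Real.sqrt (ξ * ((nl : ℝ) + 1))) ^ 2 := by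
  obtain ⟨q, hq0, hq⟩ := hq
  intro h
  have hnl : 0 < nl := by omega
  have hnl' : (0 : ℝ) < nl := by exact_mod_cast hnl
  have hq' : (0 : ℝ) < q := by exact_mod_cast hq0
  have ha2 : Real.sqrt (ξ * ((nk : ℝ) + 1)) ^ 2 = ξ * ((nk : ℝ) + 1) :=
    Real.sq_sqrt (by positivity)
  have hb2 : Real.sqrt (ξ * ((nl : ℝ) + 1)) ^ 2 = ξ * ((nl : ℝ) + 1) :=
    Real.sq_sqrt (by positivity)
  generalize Real.sqrt (ξ * ((nk : ℝ) + 1)) = a at *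
  generalize Real.sqrt (ξ * ((nl : ℝ) + 1)) = b at *
  have hc : Real.cos (2 * (Real.pi * a)) = Real.cos (2 * (Real.pi * b)) := by
    rw [Real.cos_two_mul, Real.cos_two_mul, Real.cos_sq', Real.cos_sq', h]
  obtain ⟨N, hN⟩ := Real.cos_eq_cos_iff.1 hc
  have hN2 : (b - N) ^ 2 = a ^ 2 := by
    have hpi := Real.pi_ne_zero
    rcases hN with hN | hN
    · have : b - N = a := by
        apply mul_left_cancel₀ hpi
        linarith
      rw [this]
    · have : b - N = -a := by
        apply mul_left_cancel₀ hpi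
        linarith
      rw [this]; ring
  have hlt' : (nk : ℝ) < nl := by exact_mod_cast hlt
  have hN0 : (N : ℝ) ≠ 0 := by
    intro h0
    rw [h0, sub_zero, hb2, ha2] at hN2
    have := mul_left_cancel₀ hξ.ne' hN2
    linarith
  have hξ' : ξ = (q : ℝ) ^ 2 / nl := by field_simp; exact hq
  have hb : b = (ξ * ((nl : ℝ) - nk) + N ^ 2) / (2 * N) := by
    field_simp
    linarith
  have hy : (b * nl / q) ^ 2 = (nl : ℝ) * (nl + 1) := by
    rw [div_pow, mul_pow, hb2, ← hq]
    field_simp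
  have hsq : IsSquare (((nl * (nl + 1) : ℕ)) : ℚ) := by
    refine ⟨((q : ℚ) ^ 2 / nl * ((nl : ℚ) - nk) + N ^ 2) / (2 * N) * nl / q, ?_⟩
    rw [hb, hξ'] at hy
    rw [← pow_two]
    have := hy.symm
    apply (Rat.cast_injective (α := ℝ))
    push_cast
    exact this
  rw [Rat.isSquare_natCast_iff] at hsq
  obtain ⟨r, hr⟩ := hsq
  have h1 : nl < r := by nlinarith
  have h2 : r < nl + 1 := by nlinarith
  omega
end

section
/- Let n < m be natural numbers and d ≥ 1 an integer such that α_{n+j} = α_{m+j} for all 0 ≤ j ≤ d and α_n = α_{n+d} = 0. Then for every 0 ≤ i ≤ d−1 and every finite word w over R, W(n+i, w) = W(m+i, w). (Sufficiency direction of Lemma 5.4: two Rabi sectors of the same dimension with the same transition probabilities produce identical outcome statistics, so purification fails; in particular this applies in the degenerate case, where two one-dimensional Rabi sectors exist.) -/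
open MeasureTheory Filter Real
open scoped ENNReal

/-- sufficiency direction of Lemma 5.4: if `n < m`, `d ≥ 1`,
`α_{n+j} = α_{m+j}` for all `0 ≤ j ≤ d`, and `α_n = α_{n+d} = 0`, then for every
`0 ≤ i ≤ d−1` and every finite word `w` over `R`, `W(n+i,w) = W(m+i,w)`. -/
theorem statement15 (ε β ξ η : ℝ) (hε : 0 < ε) (hξ : 0 < ξ) (hη : 0 ≤ η)
    (n m d : ℕ) (hnm : n < m) (hd : 1 ≤ d)
    (hα : ∀ j ≤ d, rabiAlpha ξ η (n + j) = rabiAlpha ξ η (m + j))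
    (hn0 : rabiAlpha ξ η n = 0) (hnd : rabiAlpha ξ η (n + d) = 0) :
    ∀ i < d, ∀ w : List Outcome,
      wordWeight β ε ξ η (n + i) w = wordWeight β ε ξ η (m + i) w := by
  intro i hi w
  induction w generalizing i with
  | nil => simp [wordWeight]
  | cons a w ih =>
    have h0 := hα i hi.le
    have h1 : rabiAlpha ξ η (n + i + 1) = rabiAlpha ξ η (m + i + 1) := hα (i + 1) hi
    cases a with
    | mm => simp only [wordWeight, stepWeight, stepSucc, h0, ih i hi]
    | pp => simp only [wordWeight, stepWeight, stepSucc, h1, ih i hi]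
    | mp =>
      simp only [wordWeight, stepWeight, stepSucc]
      rcases i with _ | i
      · rw [← h0]
        simp [hn0]
      · have := ih i (by omega)
        rw [← h0]
        simpa [← add_assoc] using Or.inl this
    | pm =>
      simp only [wordWeight, stepWeight, stepSucc]
      rw [← h1]
      rcases Nat.lt_or_ge (i + 1) d with h | h
      · have := ih (i + 1) h
        rw [← add_assoc, ← add_assoc] at this
        rw [this]
      · have hd' : n + i + 1 = n + d := by omega
        have hz : rabiAlpha ξ η (n + i + 1) = 0 := by rw [hd', hnd]
        rw [hz]
        simp
end
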